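/- arXiv:2211.15614 — 3 statements merged into one kernel-verified Lean document; each statement's English description precedes it below -/
import Mathlib

section
/- If W is a finitely generated subgroup of K^×, then there exists a positive integer z (depending on K and W) such that for all positive integers t one has [K(ζ_∞, W^{1/zt}) : K(ζ_∞, W^{1/z})] = t^{rank W}. -/
open NumberField Filter
open scoped TensorProduct Classical

noncomputable section

variable {K : Type} [Field K] [NumberField K]

/-- The relative degree `[M ⊔ L : M]` of two intermediate fields; when `M ≤ L` this is
the degree `[L : M]` (and it takes the junk value `0` when the extension is infinite). -/
def relDeg {A : Type*} [Field A] [Algebra K A] (M L : IntermediateField K A) : ℕ :=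
  Module.finrank M (IntermediateField.extendScalars (le_sup_left : M ≤ M ⊔ L))

/-- `K(ζ_∞, W^{1/m})`: the field generated over `K` (inside a fixed algebraic closure) by all
roots of unity and all `m`-th roots of elements of `W`. -/
def KWall (W : Subgroup Kˣ) (m : ℕ) : IntermediateField K (AlgebraicClosure K) :=
  IntermediateField.adjoin K
    ({x : AlgebraicClosure K | ∃ k : ℕ, 0 < k ∧ x ^ k = 1} ∪
      {x : AlgebraicClosure K |
        ∃ w : Kˣ, w ∈ W ∧ x ^ m = algebraMap K (AlgebraicClosure K) (w : K)})

/-- The (torsion-free) rank of a subgroup `W` of `Kˣ`. -/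
def grpRank {K : Type*} [Field K] (W : Subgroup Kˣ) : ℕ :=
  Module.finrank ℚ (ℚ ⊗[ℤ] Additive W)

/-- For `x` having a power in `F`, the Kummer character `σ ↦ σ x / x`, provided `F` contains all
roots of unity. -/
def kummerCharacter {F Ω : Type*} [Field F] [Field Ω] [Algebra F Ω]
    (hμ : ∀ (ζ : Ω) (n : ℕ), 0 < n → ζ ^ n = 1 → ζ ∈ Set.range (algebraMap F Ω))
    (x : Ωˣ) (hx : ∃ n : ℕ, 0 < n ∧ (x : Ω) ^ n ∈ Set.range (algebraMap F Ω)) :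
    (Ω ≃ₐ[F] Ω) →* Ω where
  toFun σ := σ x / x
  map_one' := by simp
  map_mul' σ τ := by
    obtain ⟨n, hn, a, ha⟩ := hx
    have hx0 : (x : Ω) ≠ 0 := x.ne_zero
    have hτ : (τ x / x : Ω) ^ n = 1 := by
      rw [div_pow, ← map_pow, ← ha, AlgEquiv.commutes, div_self]
      rw [ha]
      exact pow_ne_zero _ hx0
    obtain ⟨b, hb⟩ := hμ _ n hn hτ
    have h1 : τ x = algebraMap F Ω b * x := by rw [hb]; field_simp
    rw [AlgEquiv.mul_apply, h1, map_mul, AlgEquiv.commutes]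
    field_simp

/-- Elements of a Galois extension having powers in a base field containing all roots of unity are
linearly independent as soon as they lie in distinct classes modulo the base field. -/
theorem linearIndependent_of_pow_mem {F Ω : Type*} [Field F] [Field Ω] [Algebra F Ω] [IsGalois F Ω]
    (hμ : ∀ (ζ : Ω) (n : ℕ), 0 < n → ζ ^ n = 1 → ζ ∈ Set.range (algebraMap F Ω))
    {ι : Type*} (x : ι → Ωˣ)
    (hx : ∀ i, ∃ n : ℕ, 0 < n ∧ (x i : Ω) ^ n ∈ Set.range (algebraMap F Ω))
    (hinj : ∀ i j, (x i / x j : Ω) ∈ Set.range (algebraMap F Ω) → i = j) :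
    LinearIndependent F (fun i => (x i : Ω)) := by
  have hχ : Function.Injective fun i => kummerCharacter hμ (x i) (hx i) := by
    intro i j hij
    refine hinj i j ((InfiniteGalois.mem_range_algebraMap_iff_fixed _).2 fun σ => ?_)
    have h : σ (x i) / x i = σ (x j) / x j := DFunLike.congr_fun hij σ
    have hi : (x i : Ω) ≠ 0 := (x i).ne_zero
    have hj : (x j : Ω) ≠ 0 := (x j).ne_zero
    have hj' : σ (x j : Ω) ≠ 0 := by simp
    rw [map_div₀]
    field_simp at h ⊢
    linear_combination h
  have hli := (linearIndependent_monoidHom (Ω ≃ₐ[F] Ω) Ω).comp _ hχ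
  rw [linearIndependent_iff'] at hli ⊢
  intro s c hc i hi
  have h := hli s (fun i => algebraMap F Ω (c i) * x i) ?_ i hi
  · simpa using h
  · ext σ
    have h := congrArg σ hc
    rw [map_sum, map_zero] at h
    simp only [Finset.sum_apply, Pi.smul_apply, Function.comp, smul_eq_mul, Pi.zero_apply]
    rw [← h]
    refine Finset.sum_congr rfl fun j _ => ?_
    have hj : (x j : Ω) ≠ 0 := (x j).ne_zero
    simp only [kummerCharacter, MonoidHom.coe_mk, OneHom.coe_mk, Algebra.smul_def, map_mul,
      AlgEquiv.commutes]
    field_simp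

/-- The subgroup of units of `A` lying in the intermediate field `M`. -/
def unitsIn {K A : Type*} [Field K] [Field A] [Algebra K A] (M : IntermediateField K A) :
    Subgroup Aˣ where
  carrier := {u | (u : A) ∈ M}
  one_mem' := by simp
  mul_mem' ha hb := by simpa using! mul_mem ha hb
  inv_mem' ha := by simpa using ha

theorem mem_unitsIn {K A : Type*} [Field K] [Field A] [Algebra K A] {M : IntermediateField K A}
    {u : Aˣ} : u ∈ unitsIn M ↔ (u : A) ∈ M := Iff.rfl

/-- An algebraic extension generated by a multiplicative group is spanned by it. -/
theorem toSubmodule_adjoin_units {F A : Type*} [Field F] [Field A] [Algebra F A]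
    [Algebra.IsAlgebraic F A] (B : Subgroup Aˣ) :
    Subalgebra.toSubmodule (IntermediateField.adjoin F (Units.val '' (B : Set Aˣ))).toSubalgebra =
      Submodule.span F (Units.val '' (B : Set Aˣ)) := by
  rw [IntermediateField.adjoin_toSubalgebra, Algebra.adjoin_eq_span]
  congr 1
  have : Units.val '' (B : Set Aˣ) = ((B.toSubmonoid.map (Units.coeHom A) : Submonoid A) : Set A) :=
    rfl
  rw [this, Submonoid.closure_eq]

/-- Representatives of a group of radicals `B` modulo `M` are linearly independent over `M`. -/
theorem linearIndependent_quotient_out {k A : Type*} [Field k] [Field A] [Algebra k A]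
    [IsGalois k A] (M : IntermediateField k A)
    (hμ : ∀ (ζ : A) (n : ℕ), 0 < n → ζ ^ n = 1 → ζ ∈ M) (B : Subgroup Aˣ)
    (hB : ∀ u ∈ B, ∃ n : ℕ, 0 < n ∧ (u : A) ^ n ∈ M) :
    LinearIndependent M
      fun q : B ⧸ (unitsIn M).subgroupOf B => (((Quotient.out q : B) : Aˣ) : A) := by
  have hrange : Set.range (algebraMap M A) = (M : Set A) := Subtype.range_coe
  refine linearIndependent_of_pow_mem (by simpa [hrange] using hμ)
    (fun q : B ⧸ (unitsIn M).subgroupOf B => ((Quotient.out q : B) : Aˣ))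
    (fun q => by simpa [hrange] using hB _ (Quotient.out q : B).2) fun i j hij => ?_
  rw [hrange] at hij
  rw [← Quotient.out_eq i, ← Quotient.out_eq j]
  refine QuotientGroup.eq.2 ?_
  rw [Subgroup.mem_subgroupOf, mem_unitsIn]
  simpa [div_eq_mul_inv, mul_comm] using M.inv_mem hij

theorem exists_smul_quotient_out {k A : Type*} [Field k] [Field A] [Algebra k A]
    (M : IntermediateField k A) (B : Subgroup Aˣ) (u : B) :
    ∃ m : M, m ≠ 0 ∧ ((u : Aˣ) : A) =
      m • (((Quotient.out (QuotientGroup.mk u : B ⧸ (unitsIn M).subgroupOf B) : B) : Aˣ) : A) := by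
  let q : B ⧸ (unitsIn M).subgroupOf B := QuotientGroup.mk u
  have h : (Quotient.out q)⁻¹ * u ∈ (unitsIn M).subgroupOf B :=
    QuotientGroup.eq.1 (Quotient.out_eq q)
  rw [Subgroup.mem_subgroupOf, mem_unitsIn] at h
  refine ⟨⟨_, h⟩,
    fun h0 => Units.ne_zero ((Quotient.out q)⁻¹ * u : B).1 (congrArg Subtype.val h0), ?_⟩
  simp [q, Algebra.smul_def, mul_comm, IntermediateField.algebraMap_apply]

/-- Kummer theory: the degree of the extension of `M` generated by a group of radicals. -/
theorem relDeg_adjoin_units {k : Type} [Field k] {A : Type*} [Field A] [Algebra k A] [IsGalois k A]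
    (M : IntermediateField k A)
    (hμ : ∀ (ζ : A) (n : ℕ), 0 < n → ζ ^ n = 1 → ζ ∈ M) (B : Subgroup Aˣ)
    (hB : ∀ u ∈ B, ∃ n : ℕ, 0 < n ∧ (u : A) ^ n ∈ M) :
    relDeg M (IntermediateField.adjoin k (Units.val '' (B : Set Aˣ))) =
      (unitsIn M).relIndex B := by
  set L := IntermediateField.adjoin k (Units.val '' (B : Set Aˣ)) with hL
  have hext : IntermediateField.extendScalars (le_sup_left : M ≤ M ⊔ L) =
      IntermediateField.adjoin M (Units.val '' (B : Set Aˣ)) := by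
    apply le_antisymm
    · rw [IntermediateField.extendScalars_le_iff]
      refine sup_le (fun x hx => ?_) ?_
      · exact (IntermediateField.adjoin M _).algebraMap_mem ⟨x, hx⟩
      · exact IntermediateField.adjoin_le_iff.2 (IntermediateField.subset_adjoin M _)
    · refine IntermediateField.adjoin_le_iff.2 fun x hx => ?_
      exact (le_sup_right : L ≤ M ⊔ L) (IntermediateField.subset_adjoin k _ hx)
  have hli := linearIndependent_quotient_out M hμ B hB
  have hspan : Submodule.span M (Set.range fun q : B ⧸ (unitsIn M).subgroupOf B =>
      (((Quotient.out q : B) : Aˣ) : A)) = Submodule.span M (Units.val '' (B : Set Aˣ)) := by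
    apply le_antisymm
    · refine Submodule.span_mono ?_
      rintro _ ⟨q, rfl⟩
      exact ⟨_, (Quotient.out q : B).2, rfl⟩
    · refine Submodule.span_le.2 ?_
      rintro _ ⟨u, hu, rfl⟩
      obtain ⟨m, -, hm⟩ := exists_smul_quotient_out M B ⟨u, hu⟩
      change (u : A) = _ at hm
      rw [hm]
      exact Submodule.smul_mem _ _ (Submodule.subset_span ⟨_, rfl⟩)
  unfold relDeg
  rw [hext]
  change Module.finrank M (Subalgebra.toSubmodule
    (IntermediateField.adjoin M (Units.val '' (B : Set Aˣ))).toSubalgebra) = _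
  rw [toSubmodule_adjoin_units, ← hspan, Module.finrank_eq_nat_card_basis (Module.Basis.span hli)]
  rfl

/-- A radical lying in the span of a group `B` of radicals is in `B` up to a scalar. -/
theorem exists_div_mem_of_mem_span {k A : Type*} [Field k] [Field A] [Algebra k A]
    [IsGalois k A] (M : IntermediateField k A)
    (hμ : ∀ (ζ : A) (n : ℕ), 0 < n → ζ ^ n = 1 → ζ ∈ M) {B C : Subgroup Aˣ} (hBC : B ≤ C)
    (hC : ∀ u ∈ C, ∃ n : ℕ, 0 < n ∧ (u : A) ^ n ∈ M) {x : Aˣ} (hx : x ∈ C)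
    (hxB : (x : A) ∈ Submodule.span M (Units.val '' (B : Set Aˣ))) :
    ∃ b ∈ B, x / b ∈ unitsIn M := by
  have hli := linearIndependent_quotient_out M hμ C hC
  obtain ⟨m, hm0, hm⟩ := exists_smul_quotient_out M C ⟨x, hx⟩
  let π : C → C ⧸ (unitsIn M).subgroupOf C := QuotientGroup.mk
  have hle : Submodule.span M (Units.val '' (B : Set Aˣ)) ≤ Submodule.span M
      ((fun q : C ⧸ (unitsIn M).subgroupOf C => (((Quotient.out q : C) : Aˣ) : A)) ''
        (π '' {c | (c : Aˣ) ∈ B})) := by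
    refine Submodule.span_le.2 ?_
    rintro _ ⟨u, hu, rfl⟩
    obtain ⟨l, -, hl⟩ := exists_smul_quotient_out M C ⟨u, hBC hu⟩
    change (u : A) = _ at hl
    rw [hl]
    exact Submodule.smul_mem _ _ (Submodule.subset_span ⟨_, ⟨⟨u, hBC hu⟩, hu, rfl⟩, rfl⟩)
  have hmem := hle hxB
  change (x : A) = _ at hm
  rw [hm, Submodule.smul_mem_iff _ hm0] at hmem
  have himg := not_imp_not.1 (hli.notMem_span_image
    (s := π '' {c | (c : Aˣ) ∈ B}) (x := π ⟨x, hx⟩)) hmem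
  obtain ⟨b, hb, hbx⟩ := himg
  refine ⟨b, hb, ?_⟩
  have h := QuotientGroup.eq.1 hbx
  rw [Subgroup.mem_subgroupOf] at h
  rw [div_eq_inv_mul]
  exact h

/-- The subgroup of elements whose `m`-th power lies in `V` up to torsion. -/
def radical {G : Type*} [CommGroup G] (V : Subgroup G) (m : ℕ) : Subgroup G :=
  (V ⊔ CommGroup.torsion G).comap (powMonoidHom m)

theorem mem_sup_torsion {G : Type*} [CommGroup G] {V : Subgroup G} {x : G} :
    x ∈ V ⊔ CommGroup.torsion G ↔ ∃ v ∈ V, IsOfFinOrder (x / v) := by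
  rw [Subgroup.mem_sup]
  constructor
  · rintro ⟨v, hv, ζ, hζ, rfl⟩
    exact ⟨v, hv, by simpa using (CommGroup.mem_torsion ζ).1 hζ⟩
  · rintro ⟨v, hv, h⟩
    exact ⟨v, hv, x / v, h, by simp⟩

theorem mem_radical {G : Type*} [CommGroup G] {V : Subgroup G} {m : ℕ} {x : G} :
    x ∈ radical V m ↔ ∃ v ∈ V, IsOfFinOrder (x ^ m / v) := mem_sup_torsion

theorem torsion_le_radical {G : Type*} [CommGroup G] (V : Subgroup G) (m : ℕ) :
    CommGroup.torsion G ≤ radical V m := fun _ hx =>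
  mem_radical.2 ⟨1, V.one_mem, by simpa using IsOfFinOrder.pow hx⟩

theorem radical_le_radical_mul {G : Type*} [CommGroup G] (V : Subgroup G) (m t : ℕ) :
    radical V m ≤ radical V (m * t) := fun x hx => by
  obtain ⟨v, hv, h⟩ := mem_radical.1 hx
  exact mem_radical.2 ⟨v ^ t, V.pow_mem hv t, by simpa [pow_mul, div_pow] using h.pow (n := t)⟩

/-- In a finitely generated abelian group of rank `r`, the subgroup generated by `t`-th powers and
torsion has index `t ^ r`. -/
theorem index_range_pow_sup_torsion (A : Type*) [CommGroup A] [Group.FG A] (t : ℕ) :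
    ((powMonoidHom t : A →* A).range ⊔ CommGroup.torsion A).index =
      t ^ Module.finrank ℤ (Additive A) := by
  have hfin : Module.Finite ℤ (Additive A) := Module.Finite.iff_addGroup_fg.2 inferInstance
  let Q := Additive A ⧸ Submodule.torsion ℤ (Additive A)
  have hrank : Module.finrank ℤ Q = Module.finrank ℤ (Additive A) :=
    finrank_quotient_eq_of_le_torsion le_rfl
  let b : Module.Basis (Fin (Module.finrank ℤ Q)) ℤ Q := Module.finBasis ℤ Q
  let f : Additive A →ₗ[ℤ] (Fin (Module.finrank ℤ Q) → ℤ) :=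
    b.equivFun.toLinearMap ∘ₗ (Submodule.torsion ℤ (Additive A)).mkQ
  have hf : Function.Surjective f := b.equivFun.surjective.comp (Submodule.mkQ_surjective _)
  have hker : ∀ a : A, f (Additive.ofMul a) = 0 ↔ IsOfFinOrder a := by
    intro a
    simp only [f, LinearMap.comp_apply, LinearEquiv.coe_coe, map_eq_zero_iff _ b.equivFun.injective]
    refine (Submodule.Quotient.mk_eq_zero _).trans ?_
    rw [← Submodule.mem_toAddSubgroup, Submodule.torsion_int]
    exact isOfFinAddOrder_ofMul_iff
  let g : Additive A →+ (Fin (Module.finrank ℤ Q) → ZMod t) :=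
    (AddMonoidHom.compLeft (Int.castAddHom (ZMod t)) _).comp f.toAddMonoidHom
  have hg : Function.Surjective g :=
    (ZMod.intCast_surjective.comp_left).comp hf
  have hgker : (powMonoidHom t : A →* A).range ⊔ CommGroup.torsion A =
      (AddMonoidHom.toMultiplicativeRight g).ker := by
    ext a
    rw [mem_sup_torsion, MonoidHom.mem_ker]
    change _ ↔ g (Additive.ofMul a) = 0
    constructor
    · rintro ⟨_, ⟨u, rfl⟩, h⟩
      rw [← hker, powMonoidHom_apply, ofMul_div, ofMul_pow, map_sub, sub_eq_zero, map_nsmul] at h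
      ext i
      simp [g, h]
    · intro h
      have h' : ∀ i, (t : ℤ) ∣ f (Additive.ofMul a) i := fun i =>
        (ZMod.intCast_zmod_eq_zero_iff_dvd _ _).1 (congrFun h i)
      choose c hc using h'
      obtain ⟨u, hu⟩ := hf c
      refine ⟨_, ⟨Additive.toMul u, rfl⟩, ?_⟩
      rw [← hker, powMonoidHom_apply, ofMul_div, ofMul_pow, map_sub, sub_eq_zero, map_nsmul]
      ext i
      simp [hu, hc]
  rw [hgker, Subgroup.index_ker, MonoidHom.range_eq_top.2 (by exact hg), Nat.card_congr
    (Subgroup.topEquiv (G := Multiplicative (Fin (Module.finrank ℤ Q) → ZMod t))).toEquiv]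
  change Nat.card (Fin (Module.finrank ℤ Q) → ZMod t) = _
  rw [Nat.card_fun, Nat.card_zmod, Nat.card_fin, hrank]

theorem relIndex_radical {G : Type*} [CommGroup G] (V : Subgroup G) (hV : V.FG) {z t : ℕ}
    (ht : 0 < t) (hsurj : Function.Surjective (powMonoidHom (z * t) : G →* G)) :
    (radical V z).relIndex (radical V (z * t)) = t ^ Module.finrank ℤ (Additive V) := by
  have : Group.FG V := (Group.fg_iff_subgroup_fg V).2 hV
  have h1 : radical V z =
      (V.map (powMonoidHom t) ⊔ CommGroup.torsion G).comap (powMonoidHom (z * t)) := by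
    ext x
    rw [mem_radical, Subgroup.mem_comap, mem_sup_torsion]
    constructor
    · rintro ⟨v, hv, h⟩
      exact ⟨_, ⟨v, hv, rfl⟩, by simpa [pow_mul, div_pow] using h.pow (n := t)⟩
    · rintro ⟨_, ⟨v, hv, rfl⟩, h⟩
      refine ⟨v, hv, IsOfFinOrder.of_pow (n := t) ?_ ht.ne'⟩
      simpa [pow_mul, div_pow] using h
  have hle : V.map (powMonoidHom t) ≤ V := by
    rintro _ ⟨v, hv, rfl⟩
    exact V.pow_mem hv t
  have h2 : V ⊔ CommGroup.torsion G = V ⊔ (V.map (powMonoidHom t) ⊔ CommGroup.torsion G) := by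
    rw [← sup_assoc, sup_eq_left.2 hle]
  have h3 : (V.map (powMonoidHom t) ⊔ CommGroup.torsion G).subgroupOf V =
      (powMonoidHom t : V →* V).range ⊔ CommGroup.torsion V := by
    ext x
    rw [Subgroup.mem_subgroupOf, mem_sup_torsion, mem_sup_torsion]
    constructor
    · rintro ⟨_, ⟨v, hv, rfl⟩, h⟩
      exact ⟨_, ⟨⟨v, hv⟩, rfl⟩, (Submonoid.isOfFinOrder_coe (H := V.toSubmonoid)).1 h⟩
    · rintro ⟨_, ⟨v, rfl⟩, h⟩
      exact ⟨_, ⟨v, v.2, rfl⟩, (Submonoid.isOfFinOrder_coe (H := V.toSubmonoid)).2 h⟩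
  rw [h1, Subgroup.relIndex_comap, radical, Subgroup.map_comap_eq_self_of_surjective hsurj, h2,
    Subgroup.relIndex_sup_right, Subgroup.relIndex, h3, index_range_pow_sup_torsion]

theorem mem_radical_mul_of_mem_radical_map {G H : Type*} [CommGroup G] [CommGroup H] {j : H →* G}
    (hinj : Function.Injective j) {W : Subgroup H} {e N : ℕ}
    (hsat : ∀ (c : H) (n : ℕ), 0 < n → c ^ n ∈ W → c ^ e ∈ W) {x : G}
    (hx : ∀ n : ℕ, 0 < n → x ^ n ∈ j.range → x ^ N ∈ j.range ⊔ CommGroup.torsion G)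
    {n : ℕ} (hn : 0 < n) (hxn : x ∈ radical (W.map j) n) : x ∈ radical (W.map j) (N * e) := by
  obtain ⟨_, ⟨w, hw, rfl⟩, hfin⟩ := mem_radical.1 hxn
  obtain ⟨a, ha, hpow⟩ := isOfFinOrder_iff_pow_eq_one.1 hfin
  have hxna : x ^ (n * a) = j (w ^ a) := by
    rw [div_pow, div_eq_one, ← pow_mul] at hpow
    rw [hpow, map_pow]
  obtain ⟨_, ⟨c, rfl⟩, hc⟩ := mem_sup_torsion.1 (hx _ (Nat.mul_pos hn ha) ⟨_, hxna.symm⟩)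
  obtain ⟨b, hb, hcb⟩ := isOfFinOrder_iff_pow_eq_one.1 hc
  have hxNb : x ^ (N * b) = j (c ^ b) := by
    rw [div_pow, div_eq_one, ← pow_mul] at hcb
    rw [hcb, map_pow]
  have hcW : c ^ (b * (n * a)) = w ^ (a * (N * b)) := by
    apply hinj
    rw [pow_mul, map_pow, ← hxNb, pow_mul w, map_pow, ← hxna, ← pow_mul, ← pow_mul, mul_comm]
  have hce : c ^ e ∈ W :=
    hsat c _ (Nat.mul_pos hb (Nat.mul_pos hn ha)) (hcW ▸ W.pow_mem hw _)
  exact mem_radical.2 ⟨_, ⟨c ^ e, hce, rfl⟩, by simpa [pow_mul, div_pow] using hc.pow (n := e)⟩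

/-- The field generated by all roots of unity. -/
def cyclotomicClosure (K A : Type*) [Field K] [Field A] [Algebra K A] : IntermediateField K A :=
  IntermediateField.adjoin K {x : A | ∃ k : ℕ, 0 < k ∧ x ^ k = 1}

theorem comm_apply_of_mem_cyclotomicClosure {K A : Type*} [Field K] [Field A] [Algebra K A]
    (σ τ : A ≃ₐ[K] A) {x : A} (hx : x ∈ cyclotomicClosure K A) : σ (τ x) = τ (σ x) := by
  induction hx using IntermediateField.adjoin_induction with
  | mem x hx =>
    obtain ⟨n, hn, hx⟩ := hx
    have : NeZero n := ⟨hn.ne'⟩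
    have key : ∀ ρ : A ≃ₐ[K] A, ∃ m : ℕ, ρ x = x ^ m := fun ρ =>
      map_rootsOfUnity_eq_pow_self ρ.toAlgHom (rootsOfUnity.mkOfPowEq x hx)
    obtain ⟨a, ha⟩ := key σ
    obtain ⟨b, hb⟩ := key τ
    rw [hb, ha, map_pow, map_pow, ha, hb, ← pow_mul, ← pow_mul, mul_comm]
  | algebraMap a => simp
  | add x y _ _ hx hy => simp [hx, hy]
  | inv x _ hx => simp [hx]
  | mul x y _ _ hx hy => simp [hx, hy]

theorem mod_orderOf_eq_of_pow_eq_self {G : Type*} [Group G] {x : G} {k : ℕ} (h : x ^ k = x) :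
    k % orderOf x = 1 % orderOf x :=
  pow_eq_pow_iff_modEq.1 (h.trans (pow_one x).symm)

theorem exists_pow_eq_one_of_numberField (K : Type*) [Field K] [NumberField K] :
    ∃ N : ℕ, 0 < N ∧ ∀ (ζ : K) (n : ℕ), 0 < n → ζ ^ n = 1 → ζ ^ N = 1 := by
  refine ⟨NumberField.Units.torsionOrder K, NumberField.Units.torsionOrder_pos K,
    fun ζ n hn hζ => ?_⟩
  have hintegral : IsIntegral ℤ ζ := IsIntegral.of_pow hn (hζ ▸ isIntegral_one)
  let r : 𝓞 K := ⟨ζ, hintegral⟩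
  have hr : r ^ n = 1 := by
    apply FaithfulSMul.algebraMap_injective (𝓞 K) K
    rw [map_pow, map_one]
    exact hζ
  let u : (𝓞 K)ˣ := Units.ofPowEqOne r n hr hn.ne'
  have hu : u ∈ NumberField.Units.torsion K := by
    rw [NumberField.Units.torsion, CommGroup.mem_torsion, isOfFinOrder_iff_pow_eq_one]
    exact ⟨n, hn, Units.ext hr⟩
  rw [← NumberField.Units.rootsOfUnity_eq_torsion, mem_rootsOfUnity] at hu
  have h := congrArg (fun v : (𝓞 K)ˣ => algebraMap (𝓞 K) K (v : 𝓞 K)) hu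
  simpa [u, r] using! h

/-- An element of the cyclotomic closure of `K` with a power in `K` is, after raising to a
power bounding the orders of the roots of unity of `K`, an element of `K` up to torsion. -/
theorem pow_mem_range_sup_torsion {K A : Type*} [Field K] [CharZero K] [Field A] [Algebra K A]
    [IsAlgClosed A] [IsGalois K A] {N : ℕ}
    (hN : ∀ (ζ : K) (n : ℕ), 0 < n → ζ ^ n = 1 → ζ ^ N = 1)
    {x : Aˣ} (hx : (x : A) ∈ cyclotomicClosure K A) {n : ℕ} (hn : 0 < n)
    (hxn : x ^ n ∈ (Units.map (algebraMap K A : K →* A)).range) :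
    x ^ N ∈ (Units.map (algebraMap K A : K →* A)).range ⊔ CommGroup.torsion Aˣ := by
  have : CharZero A := charZero_of_injective_algebraMap (algebraMap K A).injective
  set U := (Units.map (algebraMap K A : K →* A)).range ⊔ CommGroup.torsion Aˣ with hU
  obtain ⟨c, hc⟩ := hxn
  have hcA : (x : A) ^ n = algebraMap K A c := by
    simpa using (congrArg Units.val hc).symm
  have hx0 : (x : A) ≠ 0 := x.ne_zero
  have hroot : ∀ σ : A ≃ₐ[K] A, (σ x / x : A) ^ n = 1 := fun σ => by
    rw [div_pow, ← map_pow, hcA, AlgEquiv.commutes, div_self]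
    simp
  have hn0 : NeZero (n : A) := ⟨by exact_mod_cast hn.ne'⟩
  obtain ⟨ω, hω⟩ := HasEnoughRootsOfUnity.exists_primitiveRoot A n
  have hcyc : ∀ σ : A ≃ₐ[K] A, ∃ k : ℕ, ∀ ζ : A, ζ ^ n = 1 → σ ζ = ζ ^ k := by
    intro σ
    have : NeZero n := ⟨hn.ne'⟩
    obtain ⟨k, -, hk⟩ := hω.eq_pow_of_pow_eq_one (ξ := σ ω)
      (by rw [← map_pow, hω.pow_eq_one, map_one])
    refine ⟨k, fun ζ hζ => ?_⟩
    obtain ⟨i, -, rfl⟩ := hω.eq_pow_of_pow_eq_one hζ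
    rw [map_pow, ← hk, ← pow_mul, ← pow_mul, mul_comm]
  let q : Aˣ ⧸ U := QuotientGroup.mk x
  have hq : ∀ m : ℕ, orderOf q ∣ m ↔ x ^ m ∈ U := fun m => by
    rw [orderOf_dvd_iff_pow_eq_one, ← QuotientGroup.mk_pow, QuotientGroup.eq_one_iff]
  have hqn : orderOf q ∣ n := (hq n).2 (hU ▸ Subgroup.mem_sup_left ⟨c, hc⟩)
  have hqpos : 0 < orderOf q := Nat.pos_of_dvd_of_pos hqn hn
  have hfix : ∀ (σ : A ≃ₐ[K] A) (k : ℕ), (∀ ζ : A, ζ ^ n = 1 → σ ζ = ζ ^ k) →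
      q ^ k = q := by
    intro σ k hk
    have hσx0 : σ (x : A) ≠ 0 := (map_ne_zero σ).2 hx0
    have hy : ((x : A) ^ k / σ x) ∈ Set.range (algebraMap K A) := by
      refine (InfiniteGalois.mem_range_algebraMap_iff_fixed _).2 fun τ => ?_
      have hτx0 : τ (x : A) ≠ 0 := (map_ne_zero τ).2 hx0
      have h1 : τ (x : A) = (τ x / x) * x := by field_simp
      have h2 : τ (σ (x : A)) = (τ x / x) ^ k * σ x := by
        rw [← hk _ (hroot τ), ← comm_apply_of_mem_cyclotomicClosure σ τ hx, map_div₀]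
        field_simp
      rw [map_div₀, map_pow, h2, div_pow]
      field_simp
    obtain ⟨y, hy⟩ := hy
    have hy0 : y ≠ 0 := by
      rintro rfl
      rw [map_zero] at hy
      exact div_ne_zero (pow_ne_zero _ hx0) hσx0 hy.symm
    have hmem : x ^ k / x ∈ U := by
      rw [hU, mem_sup_torsion]
      refine ⟨_, ⟨Units.mk0 y hy0, rfl⟩, isOfFinOrder_iff_pow_eq_one.2 ⟨n, hn, Units.ext ?_⟩⟩
      have := hroot σ
      have hval : ((x ^ k / x / (Units.map (algebraMap K A : K →* A)) (Units.mk0 y hy0) : Aˣ) : A)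
          = σ x / x := by
        simp only [Units.val_div_eq_div_val, Units.val_pow_eq_pow_val, Units.coe_map,
          MonoidHom.coe_coe, Units.val_mk0, hy]
        field_simp
      rw [Units.val_pow_eq_pow_val, hval, this, Units.val_one]
    rw [← QuotientGroup.eq_one_iff, QuotientGroup.mk_div, QuotientGroup.mk_pow] at hmem
    exact div_eq_one.1 hmem
  have hq0 : NeZero (orderOf q : A) := ⟨Nat.cast_ne_zero.2 hqpos.ne'⟩
  obtain ⟨ζ, hζ⟩ := HasEnoughRootsOfUnity.exists_primitiveRoot A (orderOf q)
  have hζn : ζ ^ n = 1 := by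
    obtain ⟨m, hm⟩ := hqn
    rw [hm, pow_mul, hζ.pow_eq_one, one_pow]
  have hζK : ζ ∈ Set.range (algebraMap K A) := by
    refine (InfiniteGalois.mem_range_algebraMap_iff_fixed _).2 fun σ => ?_
    obtain ⟨k, hk⟩ := hcyc σ
    have h := hfix σ k hk
    rw [hk ζ hζn]
    have hmod : k % orderOf q = 1 % orderOf q := mod_orderOf_eq_of_pow_eq_self h
    rw [← pow_mod_orderOf, ← hζ.eq_orderOf, hmod, hζ.eq_orderOf, pow_mod_orderOf, pow_one]
  obtain ⟨ξ, rfl⟩ := hζK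
  have hξ : ξ ^ orderOf q = 1 := by
    apply (algebraMap K A).injective
    rw [map_pow, hζ.pow_eq_one, map_one]
  refine (hq N).1 (hζ.dvd_of_pow_eq_one N ?_)
  rw [← map_pow, hN ξ _ hqpos hξ, map_one]

/-- In a number field, elements having a power in a finitely generated group `W` have a power of
bounded exponent in `W`. -/
theorem exists_pow_mem_of_fg {K : Type*} [Field K] [NumberField K] (W : Subgroup Kˣ) (hW : W.FG) :
    ∃ e : ℕ, 0 < e ∧ ∀ (c : Kˣ) (n : ℕ), 0 < n → c ^ n ∈ W → c ^ e ∈ W := by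
  obtain ⟨S, rfl⟩ := hW
  set W := Subgroup.closure (S : Set Kˣ) with hWdef
  let P : Set (IsDedekindDomain.HeightOneSpectrum (𝓞 K)) :=
    ⋃ w ∈ S, {v | v.valuationOfNeZero w ≠ 1}
  have hP : P.Finite := by
    refine S.finite_toSet.biUnion fun w _ => ?_
    refine ((IsDedekindDomain.HeightOneSpectrum.Support.finite (𝓞 K) (w : K)).union
      (IsDedekindDomain.HeightOneSpectrum.Support.finite (𝓞 K) ((w⁻¹ : Kˣ) : K))).subset ?_
    intro v hv
    rcases lt_or_gt_of_ne (Set.mem_ofPred_eq ▸ hv :) with h | h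
    · right
      change 1 < v.valuation K ((w⁻¹ : Kˣ) : K)
      rw [← IsDedekindDomain.HeightOneSpectrum.valuationOfNeZero_eq, map_inv]
      exact_mod_cast one_lt_inv'.2 h
    · left
      change 1 < v.valuation K (w : K)
      rw [← IsDedekindDomain.HeightOneSpectrum.valuationOfNeZero_eq]
      exact_mod_cast h
  have hfinP : Finite P := hP
  have hWP : ∀ v ∉ P, ∀ w ∈ W, v.valuationOfNeZero w = 1 := by
    intro v hv w hw
    have : W ≤ (v.valuationOfNeZero (K := K)).ker := by
      refine (Subgroup.closure_le _).2 fun s hs => ?_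
      by_contra h
      exact hv (Set.mem_biUnion hs h)
    exact this hw
  let f : Additive Kˣ →ₗ[ℤ] (P → ℤ) := LinearMap.pi fun v =>
    (MonoidHom.toAdditiveLeft (v.1.valuationOfNeZero (K := K))).toIntLinearMap
  let sat : Submodule ℤ (Additive Kˣ) := AddSubgroup.toIntSubmodule
    { carrier := {c | ∃ n : ℕ, 0 < n ∧ Additive.toMul c ^ n ∈ W}
      zero_mem' := ⟨1, one_pos, by simp⟩
      add_mem' := by
        rintro a b ⟨m, hm, ha⟩ ⟨n, hn, hb⟩
        refine ⟨m * n, Nat.mul_pos hm hn, ?_⟩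
        rw [toMul_add, mul_pow, pow_mul, mul_comm m n, pow_mul]
        exact W.mul_mem (W.pow_mem ha _) (W.pow_mem hb _)
      neg_mem' := by
        rintro a ⟨m, hm, ha⟩
        exact ⟨m, hm, by simpa using ha⟩ }
  have hunits : sat ⊓ LinearMap.ker f ≤ LinearMap.range
      (MonoidHom.toAdditive (Units.map (algebraMap (𝓞 K) K : 𝓞 K →* K))).toIntLinearMap := by
    rintro c ⟨⟨n, hn, hc⟩, hcf⟩
    have hval : ∀ v : IsDedekindDomain.HeightOneSpectrum (𝓞 K),
        v.valuationOfNeZero (Additive.toMul c) = 1 := by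
      intro v
      by_cases hv : v ∈ P
      · exact congrFun (LinearMap.mem_ker.1 hcf) ⟨v, hv⟩
      · have := hWP v hv _ hc
        rw [map_pow] at this
        exact (pow_eq_one_iff_left hn.ne').1 this
    have hintegral : ∀ u : Kˣ, (∀ v : IsDedekindDomain.HeightOneSpectrum (𝓞 K),
        v.valuationOfNeZero u = 1) → ∃ r : 𝓞 K, algebraMap (𝓞 K) K r = u := fun u hu =>
      IsDedekindDomain.HeightOneSpectrum.mem_integers_of_valuation_le_one K (u : K) fun v => by
        rw [← IsDedekindDomain.HeightOneSpectrum.valuationOfNeZero_eq, hu v]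
        exact le_rfl
    obtain ⟨r, hr⟩ := hintegral _ hval
    obtain ⟨s, hs⟩ := hintegral (Additive.toMul c)⁻¹ fun v => by rw [map_inv, hval v, inv_one]
    have hrs : r * s = 1 := by
      apply FaithfulSMul.algebraMap_injective (𝓞 K) K
      rw [map_mul, hr, hs, map_one, Units.mul_inv]
    exact ⟨Additive.ofMul (Units.mkOfMulEqOne r s hrs), Units.ext hr⟩
  have hfg : sat.FG := by
    refine Submodule.fg_of_fg_map_of_fg_inf_ker f (IsNoetherian.noetherian _) ?_
    exact isNoetherian_submodule.1 inferInstance _ hunits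
  obtain ⟨g, hg⟩ := hfg
  have hgsat : ∀ c ∈ g, ∃ n : ℕ, 0 < n ∧ Additive.toMul c ^ n ∈ W := fun c hc =>
    hg.le (Submodule.subset_span hc)
  choose! ν hν hνW using hgsat
  refine ⟨∏ c ∈ g, ν c, Finset.prod_pos hν, fun c n hn hc => ?_⟩
  have hle : sat ≤ AddSubgroup.toIntSubmodule
      (Subgroup.toAddSubgroup (W.comap (powMonoidHom (∏ c ∈ g, ν c)))) := by
    rw [← hg, Submodule.span_le]
    intro s hs
    change Additive.toMul s ^ (∏ c ∈ g, ν c) ∈ W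
    obtain ⟨k, hk⟩ := Finset.dvd_prod_of_mem ν hs
    rw [hk, pow_mul]
    exact W.pow_mem (hνW s hs) k
  exact hle (show Additive.ofMul c ∈ sat from ⟨n, hn, hc⟩)

/-- The image of a subgroup of `Kˣ` in the units of the algebraic closure. -/
def mapClosure (W : Subgroup Kˣ) : Subgroup (AlgebraicClosure K)ˣ :=
  W.map (Units.map (algebraMap K (AlgebraicClosure K) : K →* AlgebraicClosure K))

theorem finrank_mapClosure {F : Type} [Field F] (W : Subgroup Fˣ) :
    Module.finrank ℤ (Additive (mapClosure W)) = grpRank W := by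
  have hinj : Function.Injective
      (Units.map (algebraMap F (AlgebraicClosure F) : F →* AlgebraicClosure F)) :=
    Units.map_injective (algebraMap F (AlgebraicClosure F)).injective
  rw [grpRank, (TensorProduct.isBaseChange ℤ (Additive W) ℚ).finrank_eq]
  exact (MulEquiv.toAdditive (W.equivMapOfInjective _ hinj)).symm.toIntLinearEquiv.finrank_eq

theorem exists_unit_pow_eq {A : Type*} [Field A] [IsAlgClosed A] {m : ℕ} (hm : 0 < m) (u : Aˣ) :
    ∃ v : Aˣ, v ^ m = u := by
  obtain ⟨y, hy⟩ := IsAlgClosed.exists_pow_nat_eq (u : A) hm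
  have hy0 : y ≠ 0 := by
    rintro rfl
    exact u.ne_zero (by rw [← hy, zero_pow hm.ne'])
  exact ⟨Units.mk0 y hy0, Units.ext hy⟩

theorem coe_mem_of_isOfFinOrder {F : Type} [Field F]
    {M : IntermediateField F (AlgebraicClosure F)}
    (hM : cyclotomicClosure F (AlgebraicClosure F) ≤ M) {u : (AlgebraicClosure F)ˣ}
    (hu : IsOfFinOrder u) : (u : AlgebraicClosure F) ∈ M := by
  obtain ⟨n, hn, h⟩ := isOfFinOrder_iff_pow_eq_one.1 hu
  exact hM (IntermediateField.subset_adjoin F _ ⟨n, hn, by simpa using congrArg Units.val h⟩)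

theorem pow_mem_of_mem_radical {F : Type} [Field F] {M : IntermediateField F (AlgebraicClosure F)}
    (hM : cyclotomicClosure F (AlgebraicClosure F) ≤ M) {W : Subgroup Fˣ} {m : ℕ}
    {u : (AlgebraicClosure F)ˣ} (hu : u ∈ radical (mapClosure W) m) :
    (u : AlgebraicClosure F) ^ m ∈ M := by
  obtain ⟨_, ⟨w, -, rfl⟩, h⟩ := mem_radical.1 hu
  have := mul_mem (coe_mem_of_isOfFinOrder hM h) (M.algebraMap_mem (w : F))
  simpa using this

theorem KWall_eq_adjoin_radical {F : Type} [Field F] (W : Subgroup Fˣ) {m : ℕ} (hm : 0 < m) :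
    KWall W m = IntermediateField.adjoin F (Units.val '' (radical (mapClosure W) m : Set _)) := by
  apply le_antisymm
  · refine IntermediateField.adjoin_le_iff.2 (Set.union_subset ?_ ?_)
    · rintro x ⟨n, hn, hx⟩
      refine IntermediateField.subset_adjoin F _ ⟨Units.ofPowEqOne x n hx hn.ne', ?_, rfl⟩
      exact torsion_le_radical _ _ (isOfFinOrder_iff_pow_eq_one.2 ⟨n, hn, Units.ext hx⟩)
    · rintro x ⟨w, hw, hx⟩
      have hx0 : x ≠ 0 := by
        rintro rfl
        rw [zero_pow hm.ne'] at hx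
        exact w.ne_zero ((map_eq_zero _).1 hx.symm)
      refine IntermediateField.subset_adjoin F _ ⟨Units.mk0 x hx0, ?_, rfl⟩
      refine mem_radical.2 ⟨_, ⟨w, hw, rfl⟩, ?_⟩
      have hu : Units.mk0 x hx0 ^ m =
          Units.map (algebraMap F (AlgebraicClosure F) : F →* AlgebraicClosure F) w := Units.ext hx
      rw [hu, div_self']
      exact IsOfFinOrder.one
  · refine IntermediateField.adjoin_le_iff.2 ?_
    rintro _ ⟨u, hu, rfl⟩
    obtain ⟨_, ⟨w, hw, rfl⟩, h⟩ := mem_radical.1 hu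
    obtain ⟨v, hv⟩ := exists_unit_pow_eq hm (u ^ m / Units.map
      (algebraMap F (AlgebraicClosure F) : F →* AlgebraicClosure F) w)
    have hvfin : IsOfFinOrder v := IsOfFinOrder.of_pow (n := m) (hv ▸ h) hm.ne'
    have h1 : (v : AlgebraicClosure F) ∈ KWall W m := by
      obtain ⟨n, hn, h⟩ := isOfFinOrder_iff_pow_eq_one.1 hvfin
      exact IntermediateField.subset_adjoin F _
        (Or.inl ⟨n, hn, by simpa using congrArg Units.val h⟩)
    have h2 : ((u / v : (AlgebraicClosure F)ˣ) : AlgebraicClosure F) ∈ KWall W m := by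
      refine IntermediateField.subset_adjoin F _ (Or.inr ⟨w, hw, ?_⟩)
      have : (u / v) ^ m = Units.map
          (algebraMap F (AlgebraicClosure F) : F →* AlgebraicClosure F) w := by
        rw [div_pow, hv, div_div_cancel]
      simpa using congrArg Units.val this
    have h3 := mul_mem h2 h1
    rwa [← Units.val_mul, div_mul_cancel] at h3

theorem cyclotomicClosure_le_KWall {F : Type} [Field F] (W : Subgroup Fˣ) (m : ℕ) :
    cyclotomicClosure F (AlgebraicClosure F) ≤ KWall W m :=
  IntermediateField.adjoin.mono _ _ _ Set.subset_union_left

/-- There is a uniform exponent for the elements of `K(ζ_∞)` having a power in `W` up to torsion. -/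
theorem exists_mem_radical_of_mem_cyclotomicClosure (W : Subgroup Kˣ) (hW : W.FG) :
    ∃ z : ℕ, 0 < z ∧ ∀ (x : (AlgebraicClosure K)ˣ) (n : ℕ), 0 < n →
      (x : AlgebraicClosure K) ∈ cyclotomicClosure K (AlgebraicClosure K) →
      x ∈ radical (mapClosure W) n → x ∈ radical (mapClosure W) z := by
  obtain ⟨N, hN, hroots⟩ := exists_pow_eq_one_of_numberField K
  obtain ⟨e, he, hsat⟩ := exists_pow_mem_of_fg W hW
  refine ⟨N * e, Nat.mul_pos hN he, fun x n hn hx hxn => ?_⟩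
  exact mem_radical_mul_of_mem_radical_map
    (Units.map_injective (algebraMap K (AlgebraicClosure K)).injective) hsat
    (fun n hn hxn => pow_mem_range_sup_torsion hroots hx hn hxn) hn hxn

/-- **Lemma 2.2** (Proposition 3.1 of [JP]). If `W` is a finitely generated subgroup of `Kˣ`,
then there exists a positive integer `z` such that for all positive integers `t` we have
`[K(ζ_∞, W^{1/(z t)}) : K(ζ_∞, W^{1/z})] = t ^ rank W`. -/
theorem stmt1 (W : Subgroup Kˣ) (hFG : W.FG) :
    ∃ z : ℕ, 0 < z ∧ ∀ t : ℕ, 0 < t →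
      relDeg (KWall W z) (KWall W (z * t)) = t ^ grpRank W := by
  obtain ⟨z, hz, hsat⟩ := exists_mem_radical_of_mem_cyclotomicClosure W hFG
  refine ⟨z, hz, fun t ht => ?_⟩
  have hzt : 0 < z * t := Nat.mul_pos hz ht
  set M := KWall W z with hM
  set L := cyclotomicClosure K (AlgebraicClosure K) with hL
  have hLM : L ≤ M := cyclotomicClosure_le_KWall W z
  have hμL : ∀ (ζ : AlgebraicClosure K) (n : ℕ), 0 < n → ζ ^ n = 1 → ζ ∈ L := fun ζ n hn hζ =>
    IntermediateField.subset_adjoin K _ ⟨n, hn, hζ⟩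
  have hBM := KWall_eq_adjoin_radical W hz
  set B := radical (mapClosure W) z
  set C := radical (mapClosure W) (z * t)
  have hBC : B ≤ C := radical_le_radical_mul _ z t
  have hinf : unitsIn M ⊓ C = B := by
    apply le_antisymm
    · rintro x ⟨hxM, hxC⟩
      have hspan : (x : AlgebraicClosure K) ∈ Submodule.span L (Units.val '' (B : Set _)) := by
        rw [← toSubmodule_adjoin_units]
        have hle : M ≤ (IntermediateField.adjoin L (Units.val '' (B : Set _))).restrictScalars K :=
          hBM.le.trans (IntermediateField.adjoin_le_iff.2 (IntermediateField.subset_adjoin L _))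
        exact hle hxM
      obtain ⟨b, hb, hxb⟩ := exists_div_mem_of_mem_span L hμL hBC
        (fun u hu => ⟨z * t, hzt, pow_mem_of_mem_radical le_rfl hu⟩) hxC hspan
      have h := B.mul_mem (hsat (x / b) (z * t) hzt hxb (C.div_mem hxC (hBC hb))) hb
      rwa [div_mul_cancel] at h
    · refine le_inf (fun x hx => ?_) hBC
      rw [mem_unitsIn, hM, hBM]
      exact IntermediateField.subset_adjoin K _ ⟨x, hx, rfl⟩
  rw [KWall_eq_adjoin_radical W hzt, relDeg_adjoin_units M (fun ζ n hn hζ => hLM (hμL ζ n hn hζ)) C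
    (fun u hu => ⟨z * t, hzt, pow_mem_of_mem_radical hLM hu⟩), ← Subgroup.inf_relIndex_right, hinf,
    relIndex_radical (mapClosure W) ((Subgroup.fg_iff_submonoid_fg _).2
      (((Subgroup.fg_iff_submonoid_fg _).1 hFG).map _)) ht (exists_unit_pow_eq hzt),
    finrank_mapClosure]

end
end

section
/- There is a constant c (depending only on K and W_1,…,W_n) such that for every prime ℓ > c and every non-increasing tuple e_I ∈ Z_{≥0}^n, the ℓ-adic valuation of the degree [K(ζ_{ℓ^∞}, W_I^{1/ℓ^{e_I}}) : K(ζ_{ℓ^∞})] equals Σ_{i=1}^n e_i·(rank(W_{[1,i]}) − rank(W_{[1,i−1]})). -/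
open NumberField Filter
open scoped TensorProduct Classical

noncomputable section

variable {K : Type} [Field K] [NumberField K] {n : ℕ}

/-- `K(ζ_{ℓ^∞}, W_1^{1/ℓ^{e 1}}, …, W_n^{1/ℓ^{e n}})`: the field generated over `K` (inside a
fixed algebraic closure) by all `ℓ`-power roots of unity and all `ℓ^(e i)`-th roots of elements
of `W i`, for every `i`. -/
def KWinf (W : Fin n → Subgroup Kˣ) (ℓ : ℕ) (e : Fin n → ℕ) :
    IntermediateField K (AlgebraicClosure K) :=
  IntermediateField.adjoin K
    ({x : AlgebraicClosure K | ∃ k : ℕ, x ^ ℓ ^ k = 1} ∪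
      ⋃ i : Fin n, {x : AlgebraicClosure K |
        ∃ w : Kˣ, w ∈ W i ∧ x ^ ℓ ^ (e i) = algebraMap K (AlgebraicClosure K) (w : K)})

/-- The group `W_{[1,i]}` generated by the first `i` of the groups `W j`
(`0`-indexed: generated by the `W j` with `(j : ℕ) < i`). -/
def WleN (W : Fin n → Subgroup Kˣ) (i : ℕ) : Subgroup Kˣ :=
  ⨆ j : {j : Fin n // (j : ℕ) < i}, W j

/-- A tuple is non-increasing. -/
def Noninc (e : Fin n → ℕ) : Prop := ∀ i j : Fin n, i ≤ j → e j ≤ e i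

/-- With respect to the partition `𝒥_C` determined by the tuple `e`, a new interval begins
at `i + 1`, i.e. `e i - e (i+1) > C` (vacuously true at the last index `i = n - 1`). -/
def BreakAt (C : ℕ) (e : Fin n → ℕ) (i : ℕ) : Prop :=
  ∀ (h1 : i < n) (h2 : i + 1 < n), e ⟨i + 1, h2⟩ + C < e ⟨i, h1⟩

/-- The interval `[m, M]` is a member of the partition `𝒥_C` associated to the tuple `e`. -/
def IsJCInterval (C : ℕ) (e : Fin n → ℕ) (m M : Fin n) : Prop :=
  m ≤ M ∧ ((m : ℕ) = 0 ∨ BreakAt C e ((m : ℕ) - 1)) ∧ BreakAt C e (M : ℕ) ∧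
    ∀ i : ℕ, (m : ℕ) ≤ i → i < (M : ℕ) → ¬ BreakAt C e i

section Kummer

open Polynomial IntermediateField

theorem exists_pow_eq_of_isAbelianGalois {K L : Type*} [Field K] [Field L] [Algebra K L]
    [IsAbelianGalois K L] {p : ℕ} (hp : p.Prime) {ζ : L} (hζ : IsPrimitiveRoot ζ p)
    (hζK : ζ ∉ Set.range (algebraMap K L)) {g : K} {a : L} (ha : a ^ p = algebraMap K L g) :
    ∃ k : K, k ^ p = g := by
  by_contra! hg
  have hirr := X_pow_sub_C_irreducible_of_prime hp hg
  have ha0 : a ≠ 0 := by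
    rintro rfl
    rw [zero_pow hp.ne_zero] at ha
    exact hg 0 (by rw [zero_pow hp.ne_zero]; exact (algebraMap K L).injective (by simpa using ha))
  have hmin : minpoly K a = X ^ p - C g :=
    (minpoly.eq_of_irreducible_of_monic hirr (by simp [ha]) (monic_X_pow_sub_C g hp.ne_zero)).symm
  have haint : IsIntegral K a := Algebra.IsIntegral.isIntegral a
  have hfr : Module.finrank K (IntermediateField.adjoin K {a}) = p := by
    rw [IntermediateField.adjoin.finrank haint, hmin, natDegree_X_pow_sub_C]
  have hmem : ζ * a ∈ IntermediateField.adjoin K {a} := by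
    have hs : ((minpoly K a).map (algebraMap K (IntermediateField.adjoin K {a}))).Splits := by
      have := Normal.splits (F := K) (K := IntermediateField.adjoin K {a}) inferInstance
        (IntermediateField.AdjoinSimple.gen K a)
      rwa [IntermediateField.minpoly_gen] at this
    refine (IntermediateField.splits_iff_mem (Normal.splits inferInstance a)).1 hs _ ?_
    rw [mem_rootSet, hmin]
    exact ⟨hirr.ne_zero, by simp [mul_pow, hζ.pow_eq_one, ha]⟩
  have hζmem : ζ ∈ IntermediateField.adjoin K {a} := by
    have := div_mem hmem (IntermediateField.mem_adjoin_simple_self K a)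
    rwa [mul_div_cancel_right₀ _ ha0] at this
  have hdvd := IntermediateField.finrank_dvd_of_le_right
    (IntermediateField.adjoin_simple_le_iff.2 hζmem)
  rw [hfr] at hdvd
  have hζint : IsIntegral K ζ := Algebra.IsIntegral.isIntegral ζ
  have hle : Module.finrank K (IntermediateField.adjoin K {ζ}) < p := by
    rw [IntermediateField.adjoin.finrank hζint]
    have h0 : aeval ζ (cyclotomic p K) = 0 := by
      rw [aeval_def, ← eval_map, map_cyclotomic]
      exact hζ.isRoot_cyclotomic hp.pos
    have h1 := natDegree_le_of_dvd (minpoly.dvd K ζ h0) (cyclotomic_ne_zero p K)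
    rw [natDegree_cyclotomic, Nat.totient_prime hp] at h1
    have := hp.pos
    omega
  rcases (Nat.dvd_prime hp).1 hdvd with h | h
  · rw [IntermediateField.finrank_adjoin_simple_eq_one_iff] at h
    exact hζK (IntermediateField.mem_bot.1 h)
  · omega

theorem not_mem_range_of_isPrimitiveRoot {K L : Type*} [Field K] [NumberField K] [Field L]
    [Algebra K L] {p : ℕ} (hp : p.Prime) (hpK : Module.finrank ℚ K + 1 < p) {ζ : L}
    (hζ : IsPrimitiveRoot ζ p) : ζ ∉ Set.range (algebraMap K L) := by
  rintro ⟨z, rfl⟩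
  have hz : IsPrimitiveRoot z p := hζ.of_map_of_injective (algebraMap K L).injective
  have h1 := minpoly.natDegree_le (A := ℚ) z
  rw [← cyclotomic_eq_minpoly_rat hz hp.pos, natDegree_cyclotomic, Nat.totient_prime hp] at h1
  omega

theorem exists_forall_dvd_of_prod_pow_eq_pow {K : Type*} [Field K] [NumberField K] {ι : Type*}
    [Fintype ι] (b : ι → Kˣ) (hb : ∀ m : ι → ℤ, ∏ i, b i ^ m i = 1 → m = 0) :
    ∃ c : ℕ, ∀ p : ℕ, c < p → p.Prime → ∀ (m : ι → ℕ) (a : Kˣ), ∏ i, b i ^ m i = a ^ p →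
      ∀ i, p ∣ m i := by
  obtain ⟨N, hN0, hN⟩ : ∃ N : ℤ, N ≠ 0 ∧ ∀ i, IsIntegral ℤ ((N : K) * b i) := by
    have h (i : ι) : ∃ N : ℤ, N ≠ 0 ∧ IsIntegral ℤ ((N : K) * b i) := by
      have halg : IsAlgebraic ℤ (b i : K) :=
        (IsFractionRing.isAlgebraic_iff ℤ ℚ K).2 (Algebra.IsAlgebraic.isAlgebraic (b i : K))
      obtain ⟨N, h0, hN⟩ := halg.exists_integral_multiple
      exact ⟨N, h0, by simpa using hN⟩
    choose N h0 h1 using h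
    refine ⟨∏ i, N i, Finset.prod_ne_zero_iff.2 fun i _ ↦ h0 i, fun i ↦ ?_⟩
    classical
    rw [← Finset.mul_prod_erase _ _ (Finset.mem_univ i), Int.cast_mul, mul_right_comm]
    exact (h1 i).mul (isIntegral_algebraMap (R := ℤ) (A := K))
  obtain ⟨R, hR1, hR⟩ : ∃ R : ℝ, 1 ≤ R ∧ ∀ (i) (φ : K →+* ℂ), ‖φ (b i)‖ ≤ R := by
    obtain ⟨R, hR⟩ := (Set.finite_range fun x : ι × (K →+* ℂ) ↦ ‖x.2 (b x.1)‖).bddAbove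
    exact ⟨max 1 R, le_max_left _ _, fun i φ ↦ (hR ⟨(i, φ), rfl⟩).trans (le_max_right _ _)⟩
  let r := (Finset.univ : Finset ι).card
  have hfin := Embeddings.finite_of_norm_le K ℂ (‖(N : ℂ) ^ r‖ * R ^ r)
  set T := {x : K | IsIntegral ℤ x ∧ ∀ φ : K →+* ℂ, ‖φ x‖ ≤ ‖(N : ℂ) ^ r‖ * R ^ r}
  have hNK : (N : K) ≠ 0 := by exact_mod_cast hN0
  have key (p : ℕ) (hp : p.Prime) (m : ι → ℕ) (hm : ∀ i, m i < p) (a : Kˣ)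
      (ha : ∏ i, b i ^ m i = a ^ p) : (N : K) ^ r * a ∈ T := by
    have ha' : (a : K) ^ p = ∏ i, (b i : K) ^ m i := by
      simpa using (congrArg Units.val ha).symm
    constructor
    · refine IsIntegral.of_pow hp.pos ?_
      have : ((N : K) ^ r * a) ^ p = ∏ i, ((N : K) ^ (p - m i) * (N * b i) ^ m i) := by
        rw [mul_pow, ha', ← pow_mul, mul_comm r, pow_mul, ← Finset.prod_const,
          ← Finset.prod_mul_distrib]
        refine Finset.prod_congr rfl fun i _ ↦ ?_
        rw [mul_pow, ← mul_assoc, ← pow_add, Nat.sub_add_cancel (hm i).le]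
      rw [this]
      exact IsIntegral.prod _ fun i _ ↦
        ((isIntegral_algebraMap (R := ℤ) (A := K)).pow _).mul ((hN i).pow _)
    · intro φ
      rw [map_mul, norm_mul, map_pow, map_intCast]
      gcongr
      refine le_of_pow_le_pow_left₀ hp.ne_zero (by positivity) ?_
      rw [← norm_pow, ← map_pow, ha', map_prod, norm_prod, ← pow_mul, mul_comm r, pow_mul,
        ← Finset.prod_const]
      refine Finset.prod_le_prod (fun _ _ ↦ norm_nonneg _) fun i _ ↦ ?_
      rw [map_pow, norm_pow]
      exact (pow_le_pow_left₀ (norm_nonneg _) (hR i φ) _).trans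
        (pow_le_pow_right₀ hR1 (hm i).le)
  let B : Subgroup Kˣ :=
    { carrier := {x | ∃ k : ι → ℤ, ∏ i, b i ^ k i = x}
      one_mem' := ⟨0, by simp⟩
      mul_mem' := by
        rintro _ _ ⟨k, rfl⟩ ⟨l, rfl⟩
        exact ⟨k + l, by simp [zpow_add, Finset.prod_mul_distrib]⟩
      inv_mem' := by
        rintro _ ⟨k, rfl⟩
        exact ⟨-k, by simp⟩ }
  have hfin' : Set.Finite {a : Kˣ | (N : K) ^ r * a ∈ T} :=
    hfin.preimage fun x _ y _ h ↦ Units.ext (mul_left_cancel₀ (pow_ne_zero r hNK) h)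
  obtain ⟨c, hc⟩ := (hfin'.image fun a : Kˣ ↦ orderOf (a : Kˣ ⧸ B)).bddAbove
  refine ⟨c, fun p hcp hp m a ha i ↦ ?_⟩
  set a' := a / ∏ i, b i ^ (m i / p) with ha'
  have ha'p : ∏ i, b i ^ (m i % p) = a' ^ p := by
    rw [ha', div_pow, ← ha, ← Finset.prod_pow, ← Finset.prod_div_distrib]
    refine Finset.prod_congr rfl fun i _ ↦ ?_
    rw [eq_div_iff_mul_eq', ← pow_mul, ← pow_add, Nat.mod_add_div']
  have hT := key p hp (fun i ↦ m i % p) (fun i ↦ Nat.mod_lt _ hp.pos) a' ha'p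
  have hord : orderOf (a' : Kˣ ⧸ B) ∣ p := by
    rw [orderOf_dvd_iff_pow_eq_one, ← QuotientGroup.mk_pow, QuotientGroup.eq_one_iff, ← ha'p]
    exact ⟨fun i ↦ (m i % p : ℕ), by simp only [zpow_natCast]⟩
  have ha'B : a' ∈ B := by
    rcases (Nat.dvd_prime hp).1 hord with h | h
    · rwa [orderOf_eq_one_iff, QuotientGroup.eq_one_iff] at h
    · have : orderOf (a' : Kˣ ⧸ B) ≤ c := hc ⟨a', hT, rfl⟩
      omega
  obtain ⟨k, hk⟩ := ha'B
  have h0 := congrFun (hb (fun i ↦ (m i % p : ℕ) - k i * p) (by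
    simp only [zpow_sub, zpow_mul, zpow_natCast, Finset.prod_mul_distrib, Finset.prod_inv_distrib,
      Finset.prod_pow, ha'p, hk, mul_inv_cancel])) i
  rw [Pi.zero_apply, sub_eq_zero] at h0
  have h1 : p ∣ m i % p := Int.natCast_dvd_natCast.1 ⟨k i, by rw [h0, mul_comm]⟩
  exact (Nat.dvd_mod_iff dvd_rfl).1 h1

theorem exists_eq_mul_pow_of_pow_mem {F A : Type*} [Field F] [Field A] [Algebra F A] {p : ℕ}
    (hp : p.Prime) (e : ℕ) {ζ : F} (hζ : IsPrimitiveRoot ζ (p ^ (e + 1))) {a : F}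
    (hirr : Irreducible (X ^ p ^ (e + 1) - C a)) {α : A}
    (hα : α ^ p ^ (e + 1) = algebraMap F A a) {β : A} (hβ : β ∈ adjoin F {α}) {c : F}
    (hc : β ^ p = algebraMap F A c) : ∃ (f : F) (s : ℕ), c = f ^ p * a ^ s := by
  set N := p ^ (e + 1) with hN
  have hN0 : 0 < N := pow_pos hp.pos _
  rcases eq_or_ne β 0 with rfl | hβ0
  · refine ⟨0, 0, (algebraMap F A).injective ?_⟩
    simp [← hc, hp.ne_zero]
  have hint : IsIntegral F α := .of_pow hN0 (hα ▸ isIntegral_algebraMap)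
  have hmin : minpoly F α = X ^ N - C a :=
    (minpoly.eq_of_irreducible_of_monic hirr (by simp [hα]) (monic_X_pow_sub_C a hN0.ne')).symm
  obtain ⟨q, hq, rfl⟩ : ∃ q : F[X], q.natDegree < N ∧ aeval α q = β := by
    obtain ⟨q, hq, hqβ⟩ := (adjoin.powerBasis hint).exists_eq_aeval ⟨β, hβ⟩
    rw [adjoin.powerBasis_dim, hmin, natDegree_X_pow_sub_C] at hq
    refine ⟨q, hq, ?_⟩
    rw [adjoin.powerBasis_gen] at hqβ
    have := congrArg (algebraMap F⟮α⟯ A) hqβ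
    rw [← aeval_algebraMap_apply, AdjoinSimple.algebraMap_gen] at this
    exact this.symm
  -- conjugation by `α ↦ ζ α`
  have hconj : ∃ ω : F, ω ^ p = 1 ∧
      aeval (algebraMap F A ζ * α) q = algebraMap F A ω * aeval α q := by
    have h0 : aeval (algebraMap F A ζ * α) (minpoly F α) = 0 := by
      rw [hmin]
      rw [map_sub, aeval_C, map_pow, aeval_X, mul_pow, hα, ← map_pow, hζ.pow_eq_one, map_one,
        one_mul, sub_self]
    have h1 : aeval (algebraMap F A ζ * α) (q ^ p - C c) = 0 := by
      obtain ⟨r, hr⟩ := minpoly.dvd F α (p := q ^ p - C c) (by simp [hc])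
      rw [hr, map_mul, h0, zero_mul]
    have h2 : (aeval (algebraMap F A ζ * α) q / aeval α q) ^ p = 1 := by
      rw [div_pow, hc, div_eq_one_iff_eq (hc ▸ pow_ne_zero p hβ0)]
      simpa [sub_eq_zero] using h1
    have hζp : IsPrimitiveRoot (ζ ^ p ^ e) p := hζ.pow hN0 (by rw [hN, pow_succ])
    have : NeZero p := ⟨hp.ne_zero⟩
    obtain ⟨i, -, hi⟩ := (hζp.map_of_injective (algebraMap F A).injective).eq_pow_of_pow_eq_one h2
    refine ⟨(ζ ^ p ^ e) ^ i, ?_, ?_⟩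
    · rw [← pow_mul, mul_comm, pow_mul, hζp.pow_eq_one, one_pow]
    · rw [map_pow, hi, div_mul_cancel₀ _ hβ0]
  obtain ⟨ω, hω, hconj⟩ := hconj
  have hcoeff (i : ℕ) : q.coeff i * (ζ ^ i - ω) = 0 := by
    have h0 : q.comp (C ζ * X) - C ω * q = 0 := by
      by_contra hne
      have h1 := natDegree_le_of_dvd (minpoly.dvd F α (p := q.comp (C ζ * X) - C ω * q)
        (by simp [aeval_comp, hconj])) hne
      rw [hmin, natDegree_X_pow_sub_C] at h1
      have h2 : (q.comp (C ζ * X) - C ω * q).natDegree ≤ q.natDegree := by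
        refine (natDegree_sub_le _ _).trans (max_le ?_ (natDegree_C_mul_le _ _))
        refine natDegree_comp_le.trans ?_
        exact (Nat.mul_le_mul_left _ ((natDegree_C_mul_le ζ X).trans natDegree_X_le)).trans
          (mul_one _).le
      omega
    have := congrArg (fun f ↦ coeff f i) h0
    simp only [coeff_sub, comp_C_mul_X_coeff, coeff_C_mul, coeff_zero] at this
    linear_combination this
  have hq0 : q ≠ 0 := by rintro rfl; simp at hβ0
  set i := q.natDegree
  have hi : ζ ^ i = ω := by
    have := hcoeff i
    rw [mul_eq_zero, sub_eq_zero] at this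
    exact this.resolve_left (leadingCoeff_ne_zero.2 hq0)
  have hqi : q = C q.leadingCoeff * X ^ i := by
    ext j
    rw [coeff_C_mul_X_pow]
    split_ifs with h
    · rw [h]; rfl
    · have := hcoeff j
      rw [mul_eq_zero, sub_eq_zero, ← hi] at this
      rcases lt_or_ge j N with hj | hj
      · exact this.resolve_right fun hji ↦ h (hζ.pow_inj hj hq hji)
      · exact coeff_eq_zero_of_natDegree_lt (hq.trans_le hj)
  obtain ⟨s, hs⟩ : p ^ e ∣ i := by
    have : N ∣ i * p := by rw [← hζ.pow_eq_one_iff_dvd, pow_mul, hi, hω]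
    rw [hN, pow_succ] at this
    exact Nat.dvd_of_mul_dvd_mul_right hp.pos this
  refine ⟨q.leadingCoeff, s, (algebraMap F A).injective ?_⟩
  rw [← hc, hqi]
  simp only [map_mul, map_pow, aeval_C, aeval_X, leadingCoeff_mul, leadingCoeff_C,
    leadingCoeff_X_pow, mul_one, ← hα]
  rw [mul_pow, hs, ← pow_mul, ← pow_mul, hN]
  ring

universe u

theorem finrank_adjoin_roots {A : Type u} [Field A] {p : ℕ} (hp : p.Prime) (hp2 : p ≠ 2)
    {ι : Type*} (e : ι → ℕ) (α : ι → A) (s : Finset ι) :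
    ∀ (F : Type u) [Field F] [Algebra F A], (∀ k, ∃ ζ : F, IsPrimitiveRoot ζ (p ^ k)) →
      ∀ b : ι → F, (∀ i ∈ s, α i ^ p ^ e i = algebraMap F A (b i)) →
      (∀ (m : ι → ℕ) (f : F), ∏ i ∈ s, b i ^ m i = f ^ p → ∀ i ∈ s, p ∣ m i) →
      Module.finrank F (adjoin F (α '' s)) = ∏ i ∈ s, p ^ e i := by
  classical
  induction s using Finset.induction_on with
  | empty =>
    intro F _ _ _ _ _ _
    simp
  | insert j s hj ih =>
    intro F _ _ hζ b hα hb
    have hirr (k : ℕ) : Irreducible (X ^ p ^ k - C (b j)) := by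
      refine X_pow_sub_C_irreducible_of_prime_pow hp hp2 k fun f hf ↦ ?_
      have := hb (fun i ↦ if i = j then 1 else 0) f ?_ j (Finset.mem_insert_self j s)
      · simp [hp.ne_one] at this
      · rw [hf, Finset.prod_insert hj, if_pos rfl, pow_one, Finset.prod_eq_one, mul_one]
        intro i hi
        rw [if_neg (ne_of_mem_of_not_mem hi hj), pow_zero]
    have hαj := hα j (Finset.mem_insert_self j s)
    have hN0 : 0 < p ^ e j := pow_pos hp.pos _
    have hint : IsIntegral F (α j) := .of_pow hN0 (hαj ▸ isIntegral_algebraMap)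
    have hfr : Module.finrank F F⟮α j⟯ = p ^ e j := by
      rw [adjoin.finrank hint, ← minpoly.eq_of_irreducible_of_monic (hirr (e j)) (by simp [hαj])
        (monic_X_pow_sub_C _ hN0.ne'), natDegree_X_pow_sub_C]
    have hmain := ih F⟮α j⟯
      (fun k ↦ (hζ k).imp' (algebraMap F F⟮α j⟯) fun ζ h ↦
        h.map_of_injective (algebraMap F F⟮α j⟯).injective)
      (fun i ↦ algebraMap F F⟮α j⟯ (b i))
      (fun i hi ↦ hα i (Finset.mem_insert_of_mem hi))
      (fun m f hf ↦ by
        have hf' : (f : A) ^ p = algebraMap F A (∏ i ∈ s, b i ^ m i) := by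
          simpa using (congrArg (algebraMap F⟮α j⟯ A) hf).symm
        obtain ⟨g, t, hgt⟩ : ∃ (g : F) (t : ℕ), ∏ i ∈ s, b i ^ m i = g ^ p * b j ^ t := by
          rcases hej : e j with _ | k
          · have : α j = algebraMap F A (b j) := by simpa [hej] using hαj
            have hbot : F⟮α j⟯ = ⊥ := by
              rw [adjoin_simple_eq_bot_iff, this]
              exact IntermediateField.algebraMap_mem _ _
            obtain ⟨g, hg⟩ := mem_bot.1 (hbot.le f.2)
            refine ⟨g, 0, (algebraMap F A).injective ?_⟩
            rw [← hf', pow_zero, mul_one, map_pow, hg]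
          · obtain ⟨ζ, hζ⟩ := hζ (k + 1)
            rw [hej] at hαj
            exact exists_eq_mul_pow_of_pow_mem hp k hζ (hirr _) hαj f.2 hf'
        intro i hi
        have hij : i ≠ j := ne_of_mem_of_not_mem hi hj
        have := hb (fun i ↦ if i = j then t * (p - 1) else m i) (g * b j ^ t) ?_ i
          (Finset.mem_insert_of_mem hi)
        · rwa [if_neg hij] at this
        · rw [Finset.prod_insert hj, if_pos rfl, Finset.prod_congr rfl fun i hi ↦ by
            rw [if_neg (ne_of_mem_of_not_mem hi hj)], hgt]
          obtain ⟨q, rfl⟩ := Nat.exists_eq_succ_of_ne_zero hp.ne_zero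
          simp only [Nat.succ_eq_add_one, Nat.add_sub_cancel]
          ring)
    have hadj : (adjoin F⟮α j⟯ (α '' s)).restrictScalars F = adjoin F (α '' ↑(insert j s)) := by
      rw [adjoin_adjoin_left, Finset.coe_insert, Set.image_insert_eq, Set.singleton_union]
    rw [← hadj, Finset.prod_insert hj, ← hfr, ← hmain]
    exact (Module.finrank_mul_finrank F F⟮α j⟯ (adjoin F⟮α j⟯ (α '' s))).symm

end Kummer

/-- The image of a unit in the `ℚ`-vector space spanned by the group of units. -/
def unitVec {K : Type*} [Field K] (x : Kˣ) : ℚ ⊗[ℤ] Additive Kˣ := 1 ⊗ₜ Additive.ofMul x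

section unitVec
variable {K : Type*} [Field K]

theorem unitVec_one : unitVec (1 : Kˣ) = 0 := TensorProduct.tmul_zero _ _

theorem unitVec_mul (x y : Kˣ) : unitVec (x * y) = unitVec x + unitVec y :=
  TensorProduct.tmul_add _ _ _

theorem unitVec_zpow (x : Kˣ) (k : ℤ) : unitVec (x ^ k) = (k : ℚ) • unitVec x :=
  (map_zsmul (TensorProduct.mk ℤ ℚ (Additive Kˣ) 1) k (Additive.ofMul x)).trans
    (Int.cast_smul_eq_zsmul ..).symm

theorem unitVec_prod {ι : Type*} (s : Finset ι) (x : ι → Kˣ) :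
    unitVec (∏ i ∈ s, x i) = ∑ i ∈ s, unitVec (x i) := by
  rw [unitVec, ofMul_prod, TensorProduct.tmul_sum]; rfl

theorem exists_pow_eq_pow_of_unitVec_eq {x y : Kˣ} (h : unitVec x = unitVec y) :
    ∃ d : ℕ, d ≠ 0 ∧ x ^ d = y ^ d := by
  obtain ⟨⟨c, hc⟩, hcx⟩ := (IsLocalizedModule.eq_iff_exists (nonZeroDivisors ℤ)
    (TensorProduct.mk ℤ ℚ (Additive Kˣ) 1)).1 h
  have hc' : x ^ c = y ^ c := hcx
  refine ⟨c.natAbs, Int.natAbs_ne_zero.2 (nonZeroDivisors.ne_zero hc), ?_⟩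
  obtain ⟨k, rfl | rfl⟩ := Int.eq_nat_or_neg c <;> simpa using hc'

theorem exists_pow_mem_closure_of_unitVec_mem_span {S : Set Kˣ} {x : Kˣ}
    (hx : unitVec x ∈ Submodule.span ℚ (unitVec '' S)) :
    ∃ d : ℕ, d ≠ 0 ∧ x ^ d ∈ Subgroup.closure S := by
  have key (v) (hv : v ∈ Submodule.span ℚ (unitVec '' S)) :
      ∃ d : ℕ, d ≠ 0 ∧ ∃ y ∈ Subgroup.closure S, (d : ℚ) • v = unitVec y := by
    induction hv using Submodule.span_induction with
    | mem v hv =>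
      obtain ⟨y, hy, rfl⟩ := hv
      exact ⟨1, one_ne_zero, y, Subgroup.subset_closure hy, by simp⟩
    | zero => exact ⟨1, one_ne_zero, 1, one_mem _, by simp [unitVec_one]⟩
    | add v w _ _ hv hw =>
      obtain ⟨d, hd, y, hy, hdy⟩ := hv
      obtain ⟨d', hd', y', hy', hdy'⟩ := hw
      refine ⟨d * d', mul_ne_zero hd hd', y ^ (d' : ℤ) * y' ^ (d : ℤ),
        mul_mem (zpow_mem hy _) (zpow_mem hy' _), ?_⟩
      rw [unitVec_mul, unitVec_zpow, unitVec_zpow, ← hdy, ← hdy']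
      push_cast
      module
    | smul q v _ hv =>
      obtain ⟨d, hd, y, hy, hdy⟩ := hv
      refine ⟨q.den * d, mul_ne_zero q.den_nz hd, y ^ q.num, zpow_mem hy _, ?_⟩
      rw [unitVec_zpow, ← hdy, smul_smul, smul_smul]
      congr 1
      push_cast
      rw [mul_right_comm, Rat.den_mul_eq_num]
  obtain ⟨d, hd, y, hy, hdy⟩ := key _ hx
  have h1 : unitVec (x ^ d) = unitVec y := by
    rw [← hdy, ← zpow_natCast, unitVec_zpow, Int.cast_natCast]
  obtain ⟨d', hd', h2⟩ := exists_pow_eq_pow_of_unitVec_eq h1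
  exact ⟨d * d', mul_ne_zero hd hd', by rw [pow_mul, h2]; exact pow_mem hy _⟩

/-- The units whose image under `unitVec` lies in a given subspace. -/
def unitVecComap (P : Submodule ℚ (ℚ ⊗[ℤ] Additive Kˣ)) : Subgroup Kˣ where
  carrier := {x | unitVec x ∈ P}
  one_mem' := by
    rw [Set.mem_ofPred_eq, unitVec_one]
    exact zero_mem P
  mul_mem' {x y} hx hy := by
    rw [Set.mem_ofPred_eq, unitVec_mul]
    exact add_mem hx hy
  inv_mem' {x} hx := by
    rw [Set.mem_ofPred_eq, ← zpow_neg_one, unitVec_zpow]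
    exact P.smul_mem _ hx

theorem mem_unitVecComap {P : Submodule ℚ (ℚ ⊗[ℤ] Additive Kˣ)} {x : Kˣ} :
    x ∈ unitVecComap P ↔ unitVec x ∈ P := Iff.rfl

theorem grpRank_eq_finrank_span (W : Subgroup Kˣ) :
    grpRank W = Module.finrank ℚ (Submodule.span ℚ (unitVec '' (W : Set Kˣ))) := by
  let p : Submodule ℤ (Additive Kˣ) := AddSubgroup.toIntSubmodule (Subgroup.toAddSubgroup W)
  have h1 := (Submodule.toBaseChange.toLinearEquiv (A := ℚ) p).finrank_eq
  rw [Submodule.baseChange_eq_span] at h1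
  exact h1

end unitVec

theorem exists_linearIndepOn_chain {k V : Type*} [DivisionRing k] [AddCommGroup V] [Module k V]
    (U : ℕ → Set V) :
    ∃ B : ℕ → Set V, B 0 = ∅ ∧ ∀ i, LinearIndepOn k id (B i) ∧ B i ⊆ B (i + 1) ∧
      B (i + 1) ⊆ B i ∪ U i ∧ U i ⊆ Submodule.span k (B (i + 1)) := by
  have step (i : ℕ) (s : {s : Set V // LinearIndepOn k id s}) :
      ∃ t : {s : Set V // LinearIndepOn k id s}, s.1 ⊆ t.1 ∧ t.1 ⊆ s.1 ∪ U i ∧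
        U i ⊆ Submodule.span k t.1 :=
    have h : s.1 ⊆ s.1 ∪ U i := Set.subset_union_left
    ⟨⟨_, s.2.linearIndepOn_extend h⟩, s.2.subset_extend h, s.2.extend_subset h,
      Set.subset_union_right.trans (s.2.subset_span_extend h)⟩
  choose F hF using step
  let B : ℕ → {s : Set V // LinearIndepOn k id s} :=
    fun i ↦ Nat.rec ⟨∅, linearIndepOn_empty ..⟩ F i
  exact ⟨fun i ↦ (B i).1, rfl, fun i ↦ ⟨(B i).2, hF i (B i)⟩⟩

theorem exists_adapted_units {K : Type} [Field K] {n : ℕ} (W : Fin n → Subgroup Kˣ)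
    (hFG : ∀ i, (W i).FG) :
    ∃ (ι : Type) (_ : Fintype ι) (lev : ι → Fin n) (b : ι → Kˣ) (d : ℕ), d ≠ 0 ∧
      (∀ j, b j ∈ W (lev j)) ∧
      (∀ m : ι → ℤ, ∏ j, b j ^ m j = 1 → m = 0) ∧
      (∀ i, ∀ w ∈ W i, w ^ d ∈ Subgroup.closure (b '' {j | lev j ≤ i})) ∧
      ∀ e : Fin n → ℕ, ∑ j, e (lev j) =
        ∑ i : Fin n, e i * (grpRank (WleN W ((i : ℕ) + 1)) - grpRank (WleN W (i : ℕ))) := by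
  let V := ℚ ⊗[ℤ] Additive Kˣ
  let U : ℕ → Set V := fun k ↦ {v | ∃ h : k < n, v ∈ unitVec '' (W ⟨k, h⟩ : Set Kˣ)}
  obtain ⟨B, hB0, hB⟩ := exists_linearIndepOn_chain (k := ℚ) U
  choose hBli hB1 hB2 hB3 using hB
  have hBmono : Monotone B := monotone_nat_of_le_succ hB1
  have hWmono : Monotone (WleN W) := fun k l hkl ↦
    iSup_le fun j ↦ le_iSup (fun j : {j : Fin n // (j : ℕ) < l} ↦ W j) ⟨j.1, j.2.trans_le hkl⟩
  have hWle (i : Fin n) : W i ≤ WleN W (i + 1) :=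
    le_iSup (fun j : {j : Fin n // (j : ℕ) < i + 1} ↦ W j) ⟨i, Nat.lt_succ_self _⟩
  have hspan (k) : Submodule.span ℚ (B k) = Submodule.span ℚ (unitVec '' (WleN W k : Set Kˣ)) := by
    apply le_antisymm
    · refine Submodule.span_mono ?_
      induction k with
      | zero => simp [hB0]
      | succ k ih =>
        refine (hB2 k).trans (Set.union_subset (ih.trans (Set.image_mono (hWmono k.le_succ))) ?_)
        rintro _ ⟨h, x, hx, rfl⟩
        exact ⟨x, hWle ⟨k, h⟩ hx, rfl⟩
    · have h : WleN W k ≤ unitVecComap (Submodule.span ℚ (B k)) :=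
        iSup_le fun j x hx ↦ mem_unitVecComap.2
          (Submodule.span_mono (hBmono (Nat.succ_le_of_lt j.2)) (hB3 j.1 ⟨j.1.2, x, hx, rfl⟩))
      rw [Submodule.span_le]
      rintro _ ⟨x, hx, rfl⟩
      exact h hx
  have hfin (k) : (B k).Finite := by
    have : FiniteDimensional ℚ (Submodule.span ℚ (B k)) := by
      choose S hS using hFG
      have h1 : Submodule.span ℚ (B k) ≤ Submodule.span ℚ (unitVec '' (⋃ i, (S i : Set Kˣ))) := by
        have h : WleN W k ≤ unitVecComap (Submodule.span ℚ (unitVec '' ⋃ i, (S i : Set Kˣ))) := by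
          refine iSup_le fun j ↦ ?_
          rw [← hS, Subgroup.closure_le]
          exact fun x hx ↦ mem_unitVecComap.2
            (Submodule.subset_span ⟨x, Set.mem_iUnion.2 ⟨_, hx⟩, rfl⟩)
        rw [hspan, Submodule.span_le]
        rintro _ ⟨x, hx, rfl⟩
        exact h hx
      have : FiniteDimensional ℚ (Submodule.span ℚ (unitVec '' (⋃ i, (S i : Set Kˣ)))) :=
        FiniteDimensional.span_of_finite ℚ ((Set.finite_iUnion fun i ↦ (S i).finite_toSet).image _)
      exact Submodule.finiteDimensional_of_le h1
    have h2 : LinearIndependent ℚ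
        (fun x : B k ↦ (⟨x, Submodule.subset_span x.2⟩ : Submodule.span ℚ (B k))) :=
      LinearIndependent.of_comp (Submodule.subtype _) (hBli k)
    exact h2.finite_of_isNoetherian
  have hcard (k) : grpRank (WleN W k) = (B k).ncard := by
    rw [grpRank_eq_finrank_span, ← hspan]
    have := (hfin k).fintype
    rw [finrank_span_set_eq_card (hBli k), Set.ncard_eq_toFinset_card']
  let D : Fin n → Set V := fun i ↦ B (i + 1) \ B i
  have hDfin (i) : Finite (D i) := ((hfin _).subset Set.sdiff_subset).to_subtype
  have hD (i) (v : D i) : ∃ x ∈ W i, unitVec x = v :=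
    (((hB2 i v.2.1).resolve_left v.2.2)).2
  choose β hβ hβv using hD
  have : ∀ i, Fintype (D i) := fun i ↦ Fintype.ofFinite _
  let ι := Σ i : Fin n, D i
  let b : ι → Kˣ := fun j ↦ β j.1 j.2
  have hbv (j : ι) : unitVec (b j) = j.2 := hβv j.1 j.2
  have hBι (k : ℕ) : ∀ v ∈ B k, ∃ j : ι, (j.1 : ℕ) < k ∧ (j.2 : V) = v := by
    induction k with
    | zero => simp [hB0]
    | succ k ih =>
      intro v hv
      by_cases hvk : v ∈ B k
      · obtain ⟨j, hj, hjv⟩ := ih v hvk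
        exact ⟨j, hj.trans k.lt_succ_self, hjv⟩
      · obtain ⟨hk, -⟩ := (hB2 k hv).resolve_left hvk
        exact ⟨⟨⟨k, hk⟩, ⟨v, hv, hvk⟩⟩, k.lt_succ_self, rfl⟩
  have hpow (i : Fin n) (w : Kˣ) (hw : w ∈ W i) :
      ∃ d : ℕ, d ≠ 0 ∧ w ^ d ∈ Subgroup.closure (b '' {j | j.1 ≤ i}) := by
    refine exists_pow_mem_closure_of_unitVec_mem_span
      (Submodule.span_mono ?_ (hB3 i ⟨i.2, w, hw, rfl⟩))
    intro v hv
    obtain ⟨j, hj, rfl⟩ := hBι _ v hv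
    exact ⟨b j, ⟨j, Fin.le_def.2 (Nat.lt_succ_iff.1 hj), rfl⟩, hbv j⟩
  have hpow' (i : Fin n) : ∃ d : ℕ, d ≠ 0 ∧
      ∀ w ∈ W i, w ^ d ∈ Subgroup.closure (b '' {j | j.1 ≤ i}) := by
    obtain ⟨S, hS⟩ := hFG i
    have hSW (g : S) : (g : Kˣ) ∈ W i := hS ▸ Subgroup.subset_closure g.2
    choose d hd hdg using fun g : S ↦ hpow i g (hSW g)
    refine ⟨∏ g, d g, Finset.prod_ne_zero_iff.2 fun g _ ↦ hd g, fun w hw ↦ ?_⟩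
    have hle : W i ≤ (Subgroup.closure (b '' {j | j.1 ≤ i})).comap (powMonoidHom (∏ g, d g)) := by
      rw [← hS, Subgroup.closure_le]
      intro g hg
      obtain ⟨c, hc⟩ := Finset.dvd_prod_of_mem d (Finset.mem_univ ⟨g, hg⟩)
      rw [SetLike.mem_coe, Subgroup.mem_comap, powMonoidHom_apply, hc, pow_mul]
      exact pow_mem (hdg ⟨g, hg⟩) c
    exact hle hw
  choose d hd hdw using hpow'
  refine ⟨ι, inferInstance, Sigma.fst, b, ∏ i, d i, Finset.prod_ne_zero_iff.2 fun i _ ↦ hd i,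
    fun j ↦ hβ j.1 j.2, fun m hm ↦ ?_, fun i w hw ↦ ?_, fun e ↦ ?_⟩
  · have hmem (j : ι) : (j.2 : V) ∈ B n := hBmono (Nat.succ_le_of_lt j.1.2) j.2.2.1
    have hdisj {i i' : Fin n} (h : i < i') {v : V} (hv : v ∈ D i) : v ∉ D i' :=
      fun hv' ↦ hv'.2 (hBmono (Nat.succ_le_of_lt (Fin.lt_def.1 h)) hv.1)
    have hinj : Function.Injective fun j : ι ↦ (⟨j.2, hmem j⟩ : B n) := by
      rintro ⟨i, v, hv⟩ ⟨i', v', hv'⟩ h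
      obtain rfl : v = v' := congrArg Subtype.val h
      obtain rfl : i = i' := by
        rcases lt_trichotomy i i' with h | h | h
        exacts [(hdisj h hv hv').elim, h, (hdisj h hv' hv).elim]
      rfl
    have hli := (hBli n).comp _ hinj
    have h0 := congrArg unitVec hm
    simp only [unitVec_prod, unitVec_zpow, unitVec_one, hbv] at h0
    ext j
    simpa using Fintype.linearIndependent_iff.1 hli (fun j ↦ (m j : ℚ)) h0 j
  · obtain ⟨c, hc⟩ := Finset.dvd_prod_of_mem d (Finset.mem_univ i)
    rw [hc, pow_mul]
    exact pow_mem (hdw i w hw) c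
  · rw [Fintype.sum_sigma]
    refine Finset.sum_congr rfl fun i _ ↦ ?_
    rw [Finset.sum_const (e i), smul_eq_mul, mul_comm, hcard, hcard, Finset.card_univ,
      ← Set.ncard_sdiff (hB1 i) (hfin i), ← Nat.card_eq_fintype_card, Nat.card_coe_set_eq]

theorem isAbelianGalois_KWinf_zero (W : Fin n → Subgroup Kˣ) {ℓ : ℕ} (hℓ : ℓ.Prime) :
    IsAbelianGalois K (KWinf W ℓ fun _ ↦ 0) := by
  let S : Set ℕ := Set.range fun k ↦ ℓ ^ k
  have hM : KWinf W ℓ (fun _ ↦ 0) =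
      IntermediateField.adjoin K {x : AlgebraicClosure K | ∃ m ∈ S, m ≠ 0 ∧ x ^ m = 1} := by
    apply le_antisymm
    · refine IntermediateField.adjoin_le_iff.2 (Set.union_subset ?_ (Set.iUnion_subset fun i ↦ ?_))
      · rintro x ⟨k, hx⟩
        exact IntermediateField.subset_adjoin _ _ ⟨_, ⟨k, rfl⟩, pow_ne_zero k hℓ.ne_zero, hx⟩
      · rintro x ⟨w, -, hx⟩
        rw [pow_zero, pow_one] at hx
        rw [hx]
        exact IntermediateField.algebraMap_mem _ _
    · rw [IntermediateField.adjoin_le_iff]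
      rintro x ⟨_, ⟨k, rfl⟩, -, hx⟩
      exact IntermediateField.subset_adjoin _ _ (Or.inl ⟨k, hx⟩)
  have : IsCyclotomicExtension S K (KWinf W ℓ fun _ ↦ 0) := by
    rw [hM]
    refine IntermediateField.isCyclotomicExtension_adjoin_of_exists_isPrimitiveRoot S K _
      fun m _ hm ↦ ?_
    have : NeZero m := ⟨hm⟩
    exact HasEnoughRootsOfUnity.exists_primitiveRoot (AlgebraicClosure K) m
  exact IsCyclotomicExtension.isAbelianGalois S K _

theorem relDeg_KWinf_eq_finrank_adjoin {W : Fin n → Subgroup Kˣ} {ℓ : ℕ} (hℓ : ℓ.Prime)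
    {e : Fin n → ℕ} (he : Noninc e) {ι : Type} (lev : ι → Fin n) (b : ι → Kˣ)
    (hb : ∀ j, b j ∈ W (lev j)) {d : ℕ} (hd : d.Coprime ℓ)
    (hW : ∀ i, ∀ w ∈ W i, w ^ d ∈ Subgroup.closure (b '' {j | lev j ≤ i}))
    (α : ι → AlgebraicClosure K)
    (hα : ∀ j, α j ^ ℓ ^ e (lev j) = algebraMap K (AlgebraicClosure K) (b j)) :
    relDeg (KWinf W ℓ fun _ ↦ 0) (KWinf W ℓ e) =
      Module.finrank (KWinf W ℓ fun _ ↦ 0)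
        (IntermediateField.adjoin (KWinf W ℓ fun _ ↦ 0) (Set.range α)) := by
  set M := KWinf W ℓ fun _ ↦ 0 with hM
  have hζM {k : ℕ} {x : AlgebraicClosure K} (hx : x ^ ℓ ^ k = 1) : x ∈ M :=
    IntermediateField.subset_adjoin _ _ (Or.inl ⟨k, hx⟩)
  set L' := (IntermediateField.adjoin M (Set.range α)).restrictScalars K with hL'
  have hML' : M ≤ L' := fun x hx ↦
    (IntermediateField.adjoin M (Set.range α)).algebraMap_mem ⟨x, hx⟩
  have hαL' (j : ι) : α j ∈ L' := IntermediateField.subset_adjoin M _ ⟨j, rfl⟩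
  have hroot (i : Fin n) (y : Kˣ) (hy : y ∈ Subgroup.closure (b '' {j | lev j ≤ i})) :
      ∃ z ∈ L', z ^ ℓ ^ e i = algebraMap K (AlgebraicClosure K) y := by
    induction hy using Subgroup.closure_induction with
    | mem y hy =>
      obtain ⟨j, hj, rfl⟩ := hy
      refine ⟨α j ^ ℓ ^ (e (lev j) - e i), pow_mem (hαL' j) _, ?_⟩
      rw [← pow_mul, ← pow_add, Nat.sub_add_cancel (he _ _ hj), hα]
    | one => exact ⟨1, one_mem _, by simp⟩
    | mul y y' _ _ hy hy' =>
      obtain ⟨z, hz, h⟩ := hy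
      obtain ⟨z', hz', h'⟩ := hy'
      exact ⟨z * z', mul_mem hz hz', by rw [mul_pow, h, h', Units.val_mul, map_mul]⟩
    | inv y _ hy =>
      obtain ⟨z, hz, h⟩ := hy
      exact ⟨z⁻¹, inv_mem hz, by rw [inv_pow, h, Units.val_inv_eq_inv_val, map_inv₀]⟩
  have hKL' : KWinf W ℓ e ≤ L' := by
    refine IntermediateField.adjoin_le_iff.2 (Set.union_subset ?_ (Set.iUnion_subset fun i ↦ ?_))
    · rintro x ⟨k, hx⟩
      exact hML' (hζM hx)
    · rintro x ⟨w, hw, hx⟩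
      obtain ⟨z, hz, hzw⟩ := hroot i _ (hW i w hw)
      have hw0 : algebraMap K (AlgebraicClosure K) w ≠ 0 := by simp
      have hx0 : x ≠ 0 := by
        rintro rfl
        rw [zero_pow (pow_ne_zero _ hℓ.ne_zero)] at hx
        exact hw0 hx.symm
      have hxz : (x ^ d / z) ^ ℓ ^ e i = 1 := by
        rw [div_pow, hzw, ← pow_mul, mul_comm, pow_mul, hx, Units.val_pow_eq_pow_val, map_pow]
        exact div_self (pow_ne_zero d hw0)
      have hz0 : z ≠ 0 := by
        rintro rfl
        rw [div_zero, zero_pow (pow_ne_zero _ hℓ.ne_zero)] at hxz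
        exact zero_ne_one hxz
      have h1 : x ^ d ∈ L' := by
        have := mul_mem (hML' (hζM hxz)) hz
        rwa [div_mul_cancel₀ _ hz0] at this
      have h2 : x ^ ℓ ^ e i ∈ L' := hx ▸ IntermediateField.algebraMap_mem _ _
      have h3 := Nat.gcd_eq_gcd_ab d (ℓ ^ e i)
      rw [Nat.Coprime.gcd_eq_one (hd.pow_right _), Nat.cast_one] at h3
      rw [SetLike.mem_coe, ← zpow_one x, h3, zpow_add₀ hx0, zpow_mul, zpow_mul, zpow_natCast,
        zpow_natCast]
      exact mul_mem (zpow_mem h1 _) (zpow_mem h2 _)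
  have hext : IntermediateField.extendScalars (le_sup_left : M ≤ M ⊔ KWinf W ℓ e) =
      IntermediateField.adjoin M (Set.range α) := by
    apply le_antisymm
    · rw [IntermediateField.extendScalars_le_iff]
      exact sup_le hML' hKL'
    · rw [IntermediateField.adjoin_le_iff]
      rintro _ ⟨j, rfl⟩
      exact (le_sup_right : KWinf W ℓ e ≤ M ⊔ KWinf W ℓ e) (IntermediateField.subset_adjoin _ _
        (Or.inr (Set.mem_iUnion.2 ⟨lev j, b j, hb j, hα j⟩)))
  rw [relDeg, hext]

/-- **Lemma 2.3.** There is a constant `c` (depending only on `K` and `W_1, …, W_n`) such that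
for every prime `ℓ > c` and every non-increasing tuple `e`, the `ℓ`-adic valuation of
`[K(ζ_{ℓ^∞}, W_I^{1/ℓ^{e_I}}) : K(ζ_{ℓ^∞})]` equals
`Σ_{i=1}^n e_i (rank W_{[1,i]} - rank W_{[1,i-1]})`. -/
theorem stmt2 (W : Fin n → Subgroup Kˣ) (hFG : ∀ i, (W i).FG)
    (hrk : ∀ i, 0 < grpRank (W i)) :
    ∃ c : ℕ, ∀ ℓ : ℕ, c < ℓ → ℓ.Prime → ∀ e : Fin n → ℕ, Noninc e →
      padicValNat ℓ (relDeg (KWinf W ℓ (fun _ => 0)) (KWinf W ℓ e)) =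
        ∑ i : Fin n, e i * (grpRank (WleN W ((i : ℕ) + 1)) - grpRank (WleN W (i : ℕ))) := by
  obtain ⟨ι, _, lev, b, d, hd, hb, hind, hW, hsum⟩ := exists_adapted_units W hFG
  obtain ⟨c, hc⟩ := exists_forall_dvd_of_prod_pow_eq_pow b hind
  refine ⟨c + d + Module.finrank ℚ K + 2, fun ℓ hcℓ hℓ e he ↦ ?_⟩
  choose α hα using fun j ↦ IsAlgClosed.exists_pow_nat_eq
    (algebraMap K (AlgebraicClosure K) (b j)) (pow_pos hℓ.pos (e (lev j)))
  have hdℓ : d.Coprime ℓ :=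
    (hℓ.coprime_iff_not_dvd.2 fun h ↦
      absurd (Nat.le_of_dvd (Nat.pos_of_ne_zero hd) h) (by omega)).symm
  rw [relDeg_KWinf_eq_finrank_adjoin hℓ he lev b hb hdℓ hW α hα, ← hsum]
  have hab := isAbelianGalois_KWinf_zero W hℓ
  set M := KWinf W ℓ fun _ ↦ 0
  have hζ (k : ℕ) : ∃ ζ : M, IsPrimitiveRoot ζ (ℓ ^ k) := by
    have : NeZero (ℓ ^ k) := ⟨pow_ne_zero k hℓ.ne_zero⟩
    obtain ⟨ζ, hζ⟩ := HasEnoughRootsOfUnity.exists_primitiveRoot (AlgebraicClosure K) (ℓ ^ k)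
    have hζM : ζ ∈ M := IntermediateField.subset_adjoin _ _ (Or.inl ⟨k, hζ.pow_eq_one⟩)
    exact ⟨⟨ζ, hζM⟩, hζ.of_map_of_injective (f := algebraMap M (AlgebraicClosure K))
      (algebraMap M (AlgebraicClosure K)).injective⟩
  have hdeg := finrank_adjoin_roots hℓ (by omega) (fun j ↦ e (lev j)) α Finset.univ M hζ
    (fun j ↦ algebraMap K M (b j)) (fun j _ ↦ hα j) fun m f hf j _ ↦ by
      obtain ⟨ζ, hζ⟩ := hζ 1
      rw [pow_one] at hζ
      have hf' : f ^ ℓ = algebraMap K M (∏ j, (b j : K) ^ m j) := by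
        rw [← hf, map_prod]
        simp only [map_pow]
      obtain ⟨g, hg⟩ := exists_pow_eq_of_isAbelianGalois hℓ hζ
        (not_mem_range_of_isPrimitiveRoot hℓ (by omega) hζ) hf'
      have hg0 : g ≠ 0 := by
        rintro rfl
        rw [zero_pow hℓ.ne_zero] at hg
        exact Finset.prod_ne_zero_iff.2 (fun j _ ↦ pow_ne_zero (m j) (b j).ne_zero) hg.symm
      exact hc ℓ (by omega) hℓ m (Units.mk0 g hg0) (Units.ext (by simpa using hg.symm)) j
  rw [Finset.coe_univ, Set.image_univ] at hdeg
  have := Fact.mk hℓ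
  rw [hdeg, Finset.prod_pow_eq_pow_sum, padicValNat.prime_pow]

end
end

section
/- If the groups W_1,…,W_n are multiplicatively independent (that is, rank(W_{[1,i]}) − rank(W_{[1,i−1]}) = rank(W_i) for every i), then for every prime ℓ and every non-increasing tuple e_I ∈ Z_{≥0}^n, the ℓ-adic valuation of [K(ζ_{ℓ^∞}, W_I^{1/ℓ^{e_I}}) : K(ζ_{ℓ^∞})] is at most Σ_{i=1}^n e_i·rank(W_i); equivalently, the constants c_{ℓ,T} in the polynomial description of these degrees are all nonnegative. -/
open NumberField Filter
open scoped TensorProduct Classical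

noncomputable section

variable {K : Type} [Field K] [NumberField K] {n : ℕ}

section

open IntermediateField Polynomial

variable {A E : Type*} [Field A] [Field E] [Algebra A E]

theorem relfinrank_sup_adjoin_simple_of_pow_prime_mem {ℓ : ℕ} (hℓ : ℓ.Prime)
    (F : IntermediateField A E) (hμ : ∀ ζ : E, ζ ^ ℓ = 1 → ζ ∈ F) {x : E} (hx : x ^ ℓ ∈ F) :
    ∃ j ≤ 1, F.relfinrank (F ⊔ A⟮x⟯) = ℓ ^ j := by
  by_cases h : ∃ b : F, b ^ ℓ = (⟨x ^ ℓ, hx⟩ : F)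
  · obtain ⟨b, hb⟩ := h
    refine ⟨0, zero_le_one, ?_⟩
    have hb' : (b : E) ^ ℓ = x ^ ℓ := congrArg Subtype.val hb
    have hxF : x ∈ F := by
      by_cases hb0 : (b : E) = 0
      · rw [hb0, zero_pow hℓ.ne_zero] at hb'
        rw [pow_eq_zero_iff hℓ.ne_zero |>.1 hb'.symm]
        exact F.zero_mem
      · have := F.mul_mem (hμ (x / b) (by rw [div_pow, ← hb', div_self (pow_ne_zero _ hb0)])) b.2
        rwa [div_mul_cancel₀ _ hb0] at this
    rw [pow_zero, relfinrank_eq_one_iff, sup_le_iff]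
    exact ⟨le_rfl, by simpa using hxF⟩
  · refine ⟨1, le_rfl, ?_⟩
    have hirr := X_pow_sub_C_irreducible_of_prime hℓ (not_exists.1 h)
    have hev : aeval x (X ^ ℓ - C (⟨x ^ ℓ, hx⟩ : F)) = 0 := by
      simp [IntermediateField.algebraMap_apply]
    have hmin := minpoly.eq_of_irreducible_of_monic hirr hev (monic_X_pow_sub_C _ hℓ.ne_zero)
    have hint : IsIntegral F x := ⟨_, monic_X_pow_sub_C _ hℓ.ne_zero, hev⟩
    have hext : extendScalars (le_sup_left : F ≤ F ⊔ A⟮x⟯) = F⟮x⟯ := by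
      apply restrictScalars_injective A
      rw [extendScalars_restrictScalars, restrictScalars_adjoin_eq_sup]
    rw [relfinrank_eq_finrank_of_le le_sup_left, hext, adjoin.finrank hint, ← hmin,
      natDegree_X_pow_sub_C, pow_one]

theorem relfinrank_sup_adjoin_simple_of_pow_prime_pow_mem {ℓ : ℕ} (hℓ : ℓ.Prime)
    (F : IntermediateField A E) (hμ : ∀ ζ : E, ζ ^ ℓ = 1 → ζ ∈ F) {x : E} {e : ℕ}
    (hx : x ^ ℓ ^ e ∈ F) :
    ∃ j ≤ e, F.relfinrank (F ⊔ A⟮x⟯) = ℓ ^ j := by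
  induction e generalizing x with
  | zero =>
    refine ⟨0, le_rfl, ?_⟩
    rw [pow_zero, relfinrank_eq_one_iff, sup_le_iff]
    exact ⟨le_rfl, by simpa using hx⟩
  | succ e ih =>
    obtain ⟨i, hi, hi'⟩ := ih (x := x ^ ℓ) (by rwa [← pow_mul, ← pow_succ'])
    obtain ⟨j, hj, hj'⟩ := relfinrank_sup_adjoin_simple_of_pow_prime_mem hℓ (F ⊔ A⟮x ^ ℓ⟯)
      (fun ζ hζ => le_sup_left (a := F) (hμ ζ hζ)) (x := x)
      (le_sup_right (a := F) (mem_adjoin_simple_self A (x ^ ℓ)))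
    have hle : A⟮x ^ ℓ⟯ ≤ A⟮x⟯ := by
      simpa using pow_mem (mem_adjoin_simple_self A x) ℓ
    rw [sup_assoc, sup_eq_right.2 hle] at hj'
    refine ⟨i + j, add_le_add hi hj, ?_⟩
    rw [← relfinrank_mul_relfinrank (le_sup_left : F ≤ F ⊔ A⟮x ^ ℓ⟯)
      (sup_le_sup_left hle F), hi', hj', pow_add]

theorem relfinrank_sup_adjoin_image_of_pow_prime_pow_mem {ℓ : ℕ} (hℓ : ℓ.Prime)
    (F : IntermediateField A E) (hμ : ∀ ζ : E, ζ ^ ℓ = 1 → ζ ∈ F) {ι : Type*} (s : Finset ι)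
    (x : ι → E) (e : ι → ℕ) (hx : ∀ i ∈ s, x i ^ ℓ ^ e i ∈ F) :
    ∃ j ≤ ∑ i ∈ s, e i, F.relfinrank (F ⊔ adjoin A (x '' s)) = ℓ ^ j := by
  classical
  induction s using Finset.induction_on with
  | empty => exact ⟨0, le_rfl, by simp⟩
  | insert a s ha ih =>
    obtain ⟨i, hi, hi'⟩ := ih fun i hi => hx i (Finset.mem_insert_of_mem hi)
    obtain ⟨j, hj, hj'⟩ := relfinrank_sup_adjoin_simple_of_pow_prime_pow_mem hℓ
      (F ⊔ adjoin A (x '' s)) (fun ζ hζ => le_sup_left (a := F) (hμ ζ hζ)) (x := x a) (e := e a)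
      (le_sup_left (a := F) (hx a (Finset.mem_insert_self a s)))
    have hins : F ⊔ adjoin A (x '' (insert a s : Finset ι)) = F ⊔ adjoin A (x '' s) ⊔ A⟮x a⟯ := by
      rw [Finset.coe_insert, Set.image_insert_eq, Set.insert_eq, Set.union_comm,
        adjoin_union, sup_assoc]
    refine ⟨i + j, by rw [Finset.sum_insert ha]; omega, ?_⟩
    rw [hins, ← relfinrank_mul_relfinrank (le_sup_left : F ≤ F ⊔ adjoin A (x '' s)) le_sup_left,
      hi', hj', pow_add]

theorem mem_of_isOfFinOrder_of_pow_prime_pow_mem {ℓ : ℕ} (hℓ : ℓ.Prime)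
    (F : IntermediateField A E) (hμ : ∀ (ζ : E) (k : ℕ), ζ ^ ℓ ^ k = 1 → ζ ∈ F) {y : E}
    (hy : IsOfFinOrder y) {e : ℕ} (hye : y ^ ℓ ^ e ∈ F) : y ∈ F := by
  obtain ⟨a, m, hm, hN⟩ := Nat.exists_eq_pow_mul_and_not_dvd hy.orderOf_pos.ne' ℓ hℓ.ne_one
  have h1 : y ^ m ∈ F := hμ _ a (by rw [← pow_mul, mul_comm, ← hN, pow_orderOf_eq_one])
  have hcop : Nat.gcd m (ℓ ^ e) = 1 :=
    (Nat.Coprime.pow_left e ((Nat.Prime.coprime_iff_not_dvd hℓ).2 hm)).symm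
  have hy0 : y ≠ 0 := by
    rintro rfl
    obtain ⟨k, hk, hk'⟩ := isOfFinOrder_iff_pow_eq_one.1 hy
    simp [hk.ne'] at hk'
  have hb := Nat.gcd_eq_gcd_ab m (ℓ ^ e)
  rw [hcop] at hb
  have : y = (y ^ m) ^ (Nat.gcdA m (ℓ ^ e)) * (y ^ ℓ ^ e) ^ (Nat.gcdB m (ℓ ^ e)) := by
    rw [← zpow_natCast y m, ← zpow_natCast y (ℓ ^ e), ← zpow_mul, ← zpow_mul, ← zpow_add₀ hy0, ← hb]
    simp
  rw [this]
  exact F.mul_mem (zpow_mem h1 _) (zpow_mem hye _)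

end

theorem exists_isOfFinAddOrder_sub_sum_zsmul (G : Type*) [AddCommGroup G] [Module.Finite ℤ G] :
    ∃ b : Fin (Module.finrank ℚ (ℚ ⊗[ℤ] G)) → G,
      ∀ g, ∃ a : Fin (Module.finrank ℚ (ℚ ⊗[ℤ] G)) → ℤ, IsOfFinAddOrder (g - ∑ j, a j • b j) := by
  have hr : Module.finrank ℤ (G ⧸ Submodule.torsion ℤ G) = Module.finrank ℚ (ℚ ⊗[ℤ] G) := by
    rw [(TensorProduct.isBaseChange ℤ G ℚ).finrank_eq]
    exact congrArg Cardinal.toNat (rank_quotient_eq_of_le_torsion le_rfl)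
  let B := (Module.finBasis ℤ (G ⧸ Submodule.torsion ℤ G)).reindex (finCongr hr)
  choose b hb using fun j => Submodule.Quotient.mk_surjective (Submodule.torsion ℤ G) (B j)
  refine ⟨b, fun g => ⟨B.repr (Submodule.Quotient.mk g), ?_⟩⟩
  rw [← AddCommGroup.mem_torsion, ← Submodule.torsion_int, Submodule.mem_toAddSubgroup,
    ← Submodule.Quotient.mk_eq_zero, Submodule.Quotient.mk_sub, sub_eq_zero]
  change _ = (Submodule.torsion ℤ G).mkQ _
  rw [map_sum]
  simp only [map_zsmul, Submodule.mkQ_apply, hb]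
  exact (B.sum_repr _).symm

theorem Subgroup.exists_isOfFinOrder_div_prod_zpow {K : Type*} [Field K] {W : Subgroup Kˣ}
    (hW : W.FG) :
    ∃ b : Fin (grpRank W) → Kˣ, (∀ j, b j ∈ W) ∧
      ∀ w ∈ W, ∃ a : Fin (grpRank W) → ℤ, IsOfFinOrder (w / ∏ j, b j ^ a j) := by
  have : Group.FG W := (Group.fg_iff_subgroup_fg W).2 hW
  have : Module.Finite ℤ (Additive W) := Module.Finite.iff_addGroup_fg.2 inferInstance
  obtain ⟨b, hb⟩ := exists_isOfFinAddOrder_sub_sum_zsmul (Additive W)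
  refine ⟨fun j => ((b j).toMul : W), fun j => (b j).toMul.2, fun w hw => ?_⟩
  obtain ⟨a, ha⟩ := hb (Additive.ofMul ⟨w, hw⟩)
  refine ⟨a, ?_⟩
  have h := W.subtype.isOfFinOrder (isOfFinAddOrder_ofMul_iff.1 ha)
  simpa using! h

section

variable (W : Fin n → Subgroup Kˣ) (ℓ : ℕ) (e : Fin n → ℕ)

omit [NumberField K] in
theorem rootOfUnity_mem_KWinf {ζ : AlgebraicClosure K} {k : ℕ} (hζ : ζ ^ ℓ ^ k = 1) :
    ζ ∈ KWinf W ℓ e :=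
  IntermediateField.subset_adjoin _ _ (Or.inl ⟨k, hζ⟩)

omit [NumberField K] in
variable {W ℓ} in
theorem KWinf_le_sup_adjoin (hℓ : ℓ.Prime) {r : Fin n → ℕ} (b : ∀ i, Fin (r i) → Kˣ)
    (hb : ∀ i, ∀ w ∈ W i, ∃ a : Fin (r i) → ℤ, IsOfFinOrder (w / ∏ j, b i j ^ a j))
    (x : (Σ i, Fin (r i)) → AlgebraicClosure K)
    (hx : ∀ p, x p ^ ℓ ^ e p.1 = algebraMap K (AlgebraicClosure K) (b p.1 p.2))
    (e' : Fin n → ℕ) :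
    KWinf W ℓ e ≤ KWinf W ℓ e' ⊔ IntermediateField.adjoin K (Set.range x) := by
  refine IntermediateField.adjoin_le_iff.2 (Set.union_subset ?_ (Set.iUnion_subset fun i => ?_))
  · rintro ζ ⟨k, hζ⟩
    exact le_sup_left (a := KWinf W ℓ e') (rootOfUnity_mem_KWinf W ℓ e' hζ)
  · rintro z ⟨w, hw, hz⟩
    obtain ⟨a, ha⟩ := hb i w hw
    set M := KWinf W ℓ e' ⊔ IntermediateField.adjoin K (Set.range x)
    have hxM : ∏ j, x ⟨i, j⟩ ^ a j ∈ M := prod_mem fun j _ => zpow_mem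
      (le_sup_right (a := KWinf W ℓ e') (IntermediateField.subset_adjoin K _ (Set.mem_range_self _))) _
    have hx0 : ∏ j, x ⟨i, j⟩ ^ a j ≠ 0 := by
      refine Finset.prod_ne_zero_iff.2 fun j _ => zpow_ne_zero _ fun h0 => ?_
      have h := hx ⟨i, j⟩
      rw [h0, zero_pow (pow_ne_zero _ hℓ.ne_zero)] at h
      exact (b i j).ne_zero ((map_eq_zero _).1 h.symm)
    have hpow : (z / ∏ j, x ⟨i, j⟩ ^ a j) ^ ℓ ^ e i =
        algebraMap K (AlgebraicClosure K) ((w / ∏ j, b i j ^ a j : Kˣ) : K) := by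
      rw [div_pow, hz, ← Finset.prod_pow]
      have hxb (j) : (x ⟨i, j⟩ ^ a j) ^ ℓ ^ e i = algebraMap K (AlgebraicClosure K) (b i j) ^ a j := by
        rw [← hx ⟨i, j⟩, ← zpow_natCast, ← zpow_natCast, ← zpow_mul, ← zpow_mul, mul_comm]
      simp [hxb, Units.coe_prod]
    have hfin : IsOfFinOrder (z / ∏ j, x ⟨i, j⟩ ^ a j) := by
      refine IsOfFinOrder.of_pow (n := ℓ ^ e i) ?_ (pow_ne_zero _ hℓ.ne_zero)
      rw [hpow]
      obtain ⟨m, hm, h⟩ := isOfFinOrder_iff_pow_eq_one.1 ha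
      refine isOfFinOrder_iff_pow_eq_one.2 ⟨m, hm, ?_⟩
      rw [← map_pow, ← Units.val_pow_eq_pow_val, h, Units.val_one, map_one]
    have hzM := mem_of_isOfFinOrder_of_pow_prime_pow_mem hℓ M
      (fun ζ k hζ => le_sup_left (a := KWinf W ℓ e') (rootOfUnity_mem_KWinf W ℓ e' hζ)) hfin
      (e := e i) (hpow ▸ M.algebraMap_mem _)
    have h := M.mul_mem hzM hxM
    rwa [div_mul_cancel₀ _ hx0] at h

end

/-- **Remark 2.5.** If the groups `W_1, …, W_n` are multiplicatively independent (that is,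
`rank W_{[1,i]} - rank W_{[1,i-1]} = rank W_i` for every `i`), then for every prime `ℓ` and
every non-increasing tuple `e`, the `ℓ`-adic valuation of
`[K(ζ_{ℓ^∞}, W_I^{1/ℓ^{e_I}}) : K(ζ_{ℓ^∞})]` is at most `Σ_{i=1}^n e_i · rank W_i`. -/
theorem stmt4 (W : Fin n → Subgroup Kˣ) (hFG : ∀ i, (W i).FG)
    (hrk : ∀ i, 0 < grpRank (W i))
    (hindep : ∀ i : Fin n,
      grpRank (WleN W ((i : ℕ) + 1)) = grpRank (WleN W (i : ℕ)) + grpRank (W i)) :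
    ∀ ℓ : ℕ, ℓ.Prime → ∀ e : Fin n → ℕ, Noninc e →
      padicValNat ℓ (relDeg (KWinf W ℓ (fun _ => 0)) (KWinf W ℓ e)) ≤
        ∑ i : Fin n, e i * grpRank (W i) := by
  intro ℓ hℓ e _
  have : Fact ℓ.Prime := ⟨hℓ⟩
  choose b hbW hb using fun i => Subgroup.exists_isOfFinOrder_div_prod_zpow (hFG i)
  choose x hx using fun p : Σ i, Fin (grpRank (W i)) =>
    IsAlgClosed.exists_pow_nat_eq (algebraMap K (AlgebraicClosure K) (b p.1 p.2))
      (pow_pos hℓ.pos (e p.1))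
  have hsup : KWinf W ℓ (fun _ => 0) ⊔ KWinf W ℓ e =
      KWinf W ℓ (fun _ => 0) ⊔ IntermediateField.adjoin K
        (x '' ((Finset.univ : Finset (Σ i, Fin (grpRank (W i)))) : Set _)) := by
    rw [Finset.coe_univ, Set.image_univ]
    refine le_antisymm (sup_le le_sup_left (KWinf_le_sup_adjoin e hℓ b hb x hx _))
      (sup_le_sup_left (IntermediateField.adjoin_le_iff.2 ?_) _)
    rintro _ ⟨p, rfl⟩
    exact IntermediateField.subset_adjoin _ _
      (Or.inr (Set.mem_iUnion.2 ⟨p.1, b p.1 p.2, hbW p.1 p.2, hx p⟩))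
  obtain ⟨j, hj, hdeg⟩ := relfinrank_sup_adjoin_image_of_pow_prime_pow_mem hℓ
    (KWinf W ℓ fun _ => 0)
    (fun ζ hζ => rootOfUnity_mem_KWinf W ℓ _ (k := 1) (by rwa [pow_one]))
    Finset.univ x (fun p => e p.1) (fun p _ => hx p ▸ IntermediateField.algebraMap_mem _ _)
  rw [relDeg, ← IntermediateField.relfinrank_eq_finrank_of_le, hsup, hdeg, padicValNat.prime_pow]
  simpa [Fintype.sum_sigma, mul_comm] using hj

end
end
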